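/- arXiv:2102.03720 — 3 statements merged into one kernel-verified Lean document; each statement's English description precedes it below -/
import Mathlib

section
/- Let k ≥ 3, c > 0, and let G be an n-vertex graph of girth greater than 2k with more than 2c·n^(1+1/k) edges. Then there exists a bipartite subgraph G' of G such that every vertex of G' has degree at least c·n^(1/k) in G', every vertex of G' has degree at most n^(1/k)/c^(k-1) in G', and G' has at least c^k·n vertices. -/
namespace Stmt5
open SimpleGraph

theorem path_unique {V : Type*} {G : SimpleGraph V} {k : ℕ}
    (hg : ∀ (a : V) (w : G.Walk a a), w.IsCycle → 2 * k < w.length)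
    {u v : V} (p q : G.Walk u v) (hp : p.IsPath) (hq : q.IsPath)
    (hl : p.length + q.length ≤ 2 * k) : p = q := by
  classical
  let K : SimpleGraph V := SimpleGraph.fromEdgeSet {e | e ∈ p.edges ∨ e ∈ q.edges}
  have hpK : ∀ e ∈ p.edges, e ∈ K.edgeSet := by
    intro e he
    simp only [K, edgeSet_fromEdgeSet]
    exact ⟨Or.inl he, G.not_isDiag_of_mem_edgeSet (p.edges_subset_edgeSet he)⟩
  have hqK : ∀ e ∈ q.edges, e ∈ K.edgeSet := by
    intro e he
    simp only [K, edgeSet_fromEdgeSet]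
    exact ⟨Or.inr he, G.not_isDiag_of_mem_edgeSet (q.edges_subset_edgeSet he)⟩
  have hac : K.IsAcyclic := by
    intro a w hw
    have hsub : ∀ e ∈ w.edges, e ∈ p.edges ∨ e ∈ q.edges := by
      intro e he
      have := w.edges_subset_edgeSet he
      simp only [K, edgeSet_fromEdgeSet] at this
      exact this.1
    have hG : ∀ e ∈ w.edges, e ∈ G.edgeSet := by
      intro e he
      rcases hsub e he with h | h
      · exact p.edges_subset_edgeSet h
      · exact q.edges_subset_edgeSet h
    have h1 := hg a (w.transfer G hG) (hw.transfer hG)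
    rw [Walk.length_transfer] at h1
    have h2 : w.edges.toFinset.card = w.length := by
      rw [List.toFinset_card_of_nodup hw.edges_nodup, Walk.length_edges]
    have h3 : w.edges.toFinset ⊆ (p.edges ++ q.edges).toFinset := by
      intro e he
      simpa using hsub e (by simpa using he)
    have h4 := Finset.card_le_card h3
    have h5 := List.toFinset_card_le (p.edges ++ q.edges)
    rw [List.length_append, Walk.length_edges, Walk.length_edges] at h5
    omega
  have := (hac.subsingleton_path u v).elim ⟨_, hp.transfer hpK⟩ ⟨_, hq.transfer hqK⟩
  have h1 : p.transfer K hpK = q.transfer K hqK := congrArg Subtype.val this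
  have h2 : (p.transfer K hpK).support = (q.transfer K hqK).support := by rw [h1]
  rw [Walk.support_transfer, Walk.support_transfer] at h2
  exact Walk.ext_support h2

theorem layer_growth {V : Type*} [Fintype V] [DecidableEq V] {G : SimpleGraph V}
    [DecidableRel G.Adj] {k m : ℕ}
    (hg : ∀ (a : V) (w : G.Walk a a), w.IsCycle → 2 * k < w.length)
    (hd : ∀ a b, G.Adj a b → m + 1 ≤ G.degree a) (v : V) (j : ℕ) (hj : j + 1 ≤ k) :
    ∃ L : Finset V, (∀ w ∈ L, ∃ p : G.Walk v w, p.IsPath ∧ p.length = j + 1) ∧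
      G.degree v * m ^ j ≤ L.card := by
  induction j with
  | zero =>
    refine ⟨G.neighborFinset v, ?_, by simp⟩
    intro w hw
    have hw : G.Adj v w := by simpa using hw
    exact ⟨Walk.cons hw Walk.nil, by simp [hw.ne], by simp⟩
  | succ j ih =>
    obtain ⟨L, hL, hc⟩ := ih (by omega)
    have hL' : ∀ w ∈ L, ∃ x : V, ∃ p : G.Walk v w,
        p.IsPath ∧ p.length = j + 1 ∧ p.penultimate = x := by
      intro w hw
      obtain ⟨p, hp, hlen⟩ := hL w hw
      exact ⟨_, p, hp, hlen, rfl⟩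
    choose! pen hpen using hL'
    have key : ∀ w ∈ L, ∀ u, ∀ hu : G.Adj w u, u ≠ pen w →
        ∃ p : G.Walk v w, p.length = j + 1 ∧ (p.concat hu).IsPath := by
      intro w hw u hu hne
      obtain ⟨p, hp, hlen, hx⟩ := hpen w hw
      refine ⟨p, hlen, hp.concat ?_ hu⟩
      intro hmem
      apply hne
      have h1 := path_unique hg (p.dropUntil u hmem) (Walk.cons hu.symm Walk.nil)
        (hp.dropUntil hmem) (by simp [hu.ne']) (by
          have := p.length_dropUntil_le_length hmem
          rw [hlen] at this
          simp
          omega)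
      have h2 := p.take_spec hmem
      rw [h1, ← Walk.concat_eq_append] at h2
      rw [← hx, ← h2, Walk.penultimate_concat]
    refine ⟨L.biUnion fun w => (G.neighborFinset w).erase (pen w), ?_, ?_⟩
    · intro u hu
      simp only [Finset.mem_biUnion, Finset.mem_erase, mem_neighborFinset] at hu
      obtain ⟨w, hw, hne, hadj⟩ := hu
      obtain ⟨p, hlen, hp⟩ := key w hw u hadj hne
      exact ⟨p.concat hadj, hp, by simp [hlen]⟩
    · rw [Finset.card_biUnion]
      · calc G.degree v * m ^ (j + 1) = (G.degree v * m ^ j) * m := by ring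
          _ ≤ L.card * m := Nat.mul_le_mul_right _ hc
          _ = ∑ w ∈ L, m := by simp
          _ ≤ _ := by
            apply Finset.sum_le_sum
            intro w hw
            obtain ⟨p, hp, hlen, hx⟩ := hpen w hw
            have hnn : ¬ p.Nil := by
              rw [← Walk.length_eq_zero_iff, hlen]; simp
            have := hd w _ (Walk.adj_penultimate hnn).symm
            have h2 := Finset.pred_card_le_card_erase (s := G.neighborFinset w) (a := pen w)
            rw [card_neighborFinset_eq_degree] at h2
            omega
      · intro w hw w' hw' hww
        rw [Function.onFun, Finset.disjoint_left]
        intro u hu hu'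
        simp only [Finset.mem_erase, mem_neighborFinset] at hu hu'
        apply hww
        obtain ⟨p, hlen, hp⟩ := key w hw u hu.2 hu.1
        obtain ⟨p', hlen', hp'⟩ := key w' hw' u hu'.2 hu'.1
        have h1 := path_unique hg (p.concat hu.2) (p'.concat hu'.2) hp hp' (by
            simp [hlen, hlen']; omega)
        have h2 := congrArg Walk.penultimate h1
        simpa using h2

theorem exists_core {V : Type*} [Fintype V] [DecidableEq V] (G : SimpleGraph V)
    [DecidableRel G.Adj] (t : ℝ) (h : t * Fintype.card V < G.edgeFinset.card) :
    ∃ S : Finset V, S.Nonempty ∧ ∀ v ∈ S, t < ((S.filter (G.Adj v)).card : ℝ) := by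
  let f : Finset V → ℝ := fun S => ∑ v ∈ S, ∑ w ∈ S, if G.Adj v w then (1 : ℝ) else 0
  have hdeg : ∀ (S : Finset V) v, (∑ w ∈ S, if G.Adj v w then (1 : ℝ) else 0)
      = ((S.filter (G.Adj v)).card : ℝ) := by
    intro S v; simp
  let F : Finset (Finset V) := Finset.univ.filter fun S => 2 * t * S.card < f S
  have hF : F.Nonempty := by
    refine ⟨Finset.univ, ?_⟩
    simp only [F, Finset.mem_filter, Finset.mem_univ, true_and, f, hdeg]
    have h1 := G.sum_degrees_eq_twice_card_edges
    have h2 : ∑ v, ((Finset.univ.filter (G.Adj v)).card : ℝ) = 2 * G.edgeFinset.card := by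
      have : ∀ v, (Finset.univ.filter (G.Adj v)).card = G.degree v := by
        intro v; rw [← card_neighborFinset_eq_degree, neighborFinset_eq_filter]
      simp only [this]
      exact_mod_cast h1
    rw [h2, Finset.card_univ]
    linarith
  obtain ⟨S, hS, hmin⟩ := F.exists_min_image Finset.card hF
  have hS' : 2 * t * S.card < f S := by simpa [F] using hS
  refine ⟨S, ?_, ?_⟩
  · rw [Finset.nonempty_iff_ne_empty]
    rintro rfl
    simp [f] at hS'
  · intro v hv
    by_contra hlt
    push Not at hlt
    have hnot : S.erase v ∉ F := by
      intro hmem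
      have := hmin _ hmem
      have := Finset.card_erase_lt_of_mem hv
      omega
    have hle : f (S.erase v) ≤ 2 * t * (S.erase v).card := by
      by_contra hh
      push Not at hh
      exact hnot (by simpa [F] using hh)
    have hsplit : f S = f (S.erase v) + 2 * ((S.filter (G.Adj v)).card : ℝ) := by
      have e1 : ∀ w, (∑ u ∈ S, if G.Adj w u then (1 : ℝ) else 0) =
          (∑ u ∈ S.erase v, if G.Adj w u then (1 : ℝ) else 0) + if G.Adj w v then 1 else 0 :=
        fun w => (Finset.sum_erase_add S _ hv).symm
      have e2 : f S = (∑ w ∈ S.erase v, ∑ u ∈ S, if G.Adj w u then (1 : ℝ) else 0) +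
          ∑ u ∈ S, if G.Adj v u then (1 : ℝ) else 0 :=
        (Finset.sum_erase_add S _ hv).symm
      have e3 : (∑ w ∈ S.erase v, if G.Adj w v then (1 : ℝ) else 0) =
          ∑ u ∈ S, if G.Adj v u then (1 : ℝ) else 0 := by
        rw [e1 v]
        simp [G.adj_comm]
      rw [e2, ← hdeg]
      simp only [e1 (_ : V)] at e3 ⊢
      rw [Finset.sum_add_distrib, e3]
      simp only [f]
      ring
    have hc : ((S.erase v).card : ℝ) = S.card - 1 := by
      rw [Finset.card_erase_of_mem hv, Nat.cast_sub (Finset.card_pos.2 ⟨v, hv⟩)]; simp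
    rw [hc] at hle
    linarith

theorem exists_cut {V : Type*} [Fintype V] [DecidableEq V] (G : SimpleGraph V)
    [DecidableRel G.Adj] :
    ∃ X : Finset V, ∀ v, G.degree v ≤
      2 * (Finset.univ.filter fun w => G.Adj v w ∧ (v ∈ X ↔ w ∉ X)).card := by
  let sg : Finset V → V → ℤ := fun X v => if v ∈ X then 1 else -1
  let A : V → V → ℤ := fun a b => if G.Adj a b then 1 else 0
  let Q : (V → ℤ) → ℤ := fun s => ∑ a, ∑ b, A a b * s a * s b
  obtain ⟨X, -, hX⟩ := (Finset.univ : Finset (Finset V)).exists_min_image (fun X => Q (sg X))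
    ⟨∅, Finset.mem_univ _⟩
  refine ⟨X, fun v => ?_⟩
  obtain ⟨X', hX'⟩ : ∃ X', sg X' = fun w => sg X w + (if w = v then -2 * sg X v else 0) := by
    refine ⟨Finset.univ.filter fun w => if w = v then w ∉ X else w ∈ X, ?_⟩
    funext w
    by_cases hw : w = v
    · subst hw
      by_cases h : w ∈ X <;> simp [sg, h]
    · simp [sg, hw]
  have hQ : ∀ (s : V → ℤ) (t : ℤ), Q (fun w => s w + if w = v then t else 0) =
      Q s + 2 * t * ∑ b, A v b * s b := by
    intro s t
    have hs : ∀ a, A a v = A v a := fun a => by simp [A, G.adj_comm]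
    have h0 : A v v = 0 := by simp [A]
    simp only [Q, mul_add, add_mul, Finset.sum_add_distrib]
    simp [h0, hs, Finset.mul_sum, mul_ite, ite_mul]
    rw [← sub_eq_zero]
    simp only [← Finset.sum_add_distrib, ← Finset.sum_sub_distrib]
    apply Finset.sum_eq_zero
    intro x _
    ring
  have h1 := hX X' (Finset.mem_univ _)
  simp only [hX', hQ] at h1
  have h2 : ∑ b, A v b * (sg X v * sg X b) ≤ 0 := by
    have : ∑ b, A v b * (sg X v * sg X b) = sg X v * ∑ b, A v b * sg X b := by
      rw [Finset.mul_sum]; exact Finset.sum_congr rfl fun _ _ => by ring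
    rw [this]; linarith
  have h3 : ∀ b, A v b * (sg X v * sg X b) =
      A v b - 2 * (if G.Adj v b ∧ (v ∈ X ↔ b ∉ X) then 1 else 0) := by
    intro b
    by_cases ha : G.Adj v b <;> by_cases hv : v ∈ X <;> by_cases hb : b ∈ X <;>
      simp [A, sg, ha, hv, hb]
  simp only [h3, Finset.sum_sub_distrib, ← Finset.mul_sum] at h2
  have h4 : ∑ b, A v b = G.degree v := by
    rw [← card_neighborFinset_eq_degree, neighborFinset_eq_filter]; simp [A]
  rw [h4, Finset.sum_boole] at h2
  have : (G.degree v : ℤ) ≤ 2 * ((Finset.univ.filter fun w => G.Adj v w ∧ (v ∈ X ↔ w ∉ X)).card : ℤ) := by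
    linarith
  exact_mod_cast this

end Stmt5

/-- An `n`-vertex graph of girth greater than `2k` (`k ≥ 3`) with more
than `2c·n^(1+1/k)` edges contains a bipartite subgraph `G'` with minimum degree at
least `c·n^(1/k)`, maximum degree at most `n^(1/k)/c^(k-1)`, and at least `c^k·n`
vertices. -/
theorem stmt_5 {V : Type*} [Fintype V] [DecidableEq V]
    (G : SimpleGraph V) [DecidableRel G.Adj]
    (k : ℕ) (hk : 3 ≤ k) (c : ℝ) (hc : 0 < c)
    (hgirth : (2 * k : ℕ∞) < G.girth)
    (hedges : 2 * c * (Fintype.card V : ℝ) ^ (1 + 1 / (k : ℝ)) <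
      (G.edgeFinset.card : ℝ)) :
    ∃ (G' : G.Subgraph) (X Y : Set V),
      G'.verts = X ∪ Y ∧ Disjoint X Y ∧
      (∀ a b : V, G'.Adj a b → (a ∈ X ∧ b ∈ Y) ∨ (a ∈ Y ∧ b ∈ X)) ∧
      (∀ v ∈ G'.verts,
        c * (Fintype.card V : ℝ) ^ ((1 : ℝ) / k) ≤ ((G'.neighborSet v).ncard : ℝ) ∧
        ((G'.neighborSet v).ncard : ℝ) ≤ (Fintype.card V : ℝ) ^ ((1 : ℝ) / k) / c ^ (k - 1)) ∧
      c ^ k * (Fintype.card V : ℝ) ≤ (G'.verts.ncard : ℝ) := by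
  classical
  have hgG : ∀ (a : V) (w : G.Walk a a), w.IsCycle → 2 * k < w.length := by
    intro a w hw
    have h1 := SimpleGraph.girth_le_length hw
    have h2 : 2 * k < G.girth := by exact_mod_cast hgirth
    omega
  set n : ℕ := Fintype.card V with hn
  set r : ℝ := (n : ℝ) ^ ((1 : ℝ) / k) with hr
  have hk0 : k ≠ 0 := by omega
  have hr0 : 0 ≤ r := Real.rpow_nonneg (Nat.cast_nonneg _) _
  have hrk : r ^ k = n := by
    rw [hr, one_div]
    exact Real.rpow_inv_natCast_pow (Nat.cast_nonneg _) hk0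
  have hpow : (n : ℝ) ^ (1 + 1 / (k : ℝ)) = n * r := by
    rw [Real.rpow_add' (Nat.cast_nonneg _) (by positivity), Real.rpow_one]
  rw [hpow] at hedges
  obtain ⟨S, ⟨v0, hv0⟩, hS⟩ := Stmt5.exists_core G (2 * (c * r)) (by rw [← hn]; linarith)
  have hnpos : 0 < n := Fintype.card_pos_iff.2 ⟨v0⟩
  have hrpos : 0 < r := by
    rcases hr0.eq_or_lt with h | h
    · rw [← h, zero_pow hk0] at hrk
      have : n = 0 := by exact_mod_cast hrk.symm
      omega
    · exact h
  set d : ℝ := c * r with hd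
  have hdpos : 0 < d := by positivity
  let H : SimpleGraph V :=
    { Adj := fun a b => G.Adj a b ∧ a ∈ S ∧ b ∈ S
      symm := ⟨fun a b h => ⟨h.1.symm, h.2.2, h.2.1⟩⟩
      loopless := ⟨fun a h => G.loopless.irrefl a h.1⟩ }
  have hHG : H ≤ G := fun a b h => h.1
  have hgH : ∀ (a : V) (w : H.Walk a a), w.IsCycle → 2 * k < w.length := by
    intro a w hw
    have hE : ∀ e ∈ w.edges, e ∈ G.edgeSet := fun e he =>
      SimpleGraph.edgeSet_mono hHG (w.edges_subset_edgeSet he)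
    have := hgG a (w.transfer G hE) (hw.transfer hE)
    rwa [SimpleGraph.Walk.length_transfer] at this
  have hdegH : ∀ v ∈ S, 2 * d < (H.degree v : ℝ) := by
    intro v hv
    have h1 : H.degree v = (S.filter (G.Adj v)).card := by
      rw [← SimpleGraph.card_neighborFinset_eq_degree, SimpleGraph.neighborFinset_eq_filter]
      congr 1
      ext w
      simp [H, hv, and_comm]
    rw [h1]
    exact hS v hv
  -- the Moore-type bound
  have moore : ∀ v ∈ S, (H.degree v : ℝ) * d ^ (k - 1) ≤ S.card ∨ d < 1 := by
    intro v hv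
    by_cases hd1 : d < 1
    · exact Or.inr hd1
    left
    push Not at hd1
    let m : ℕ := ⌊2 * d⌋₊
    have hm : d ≤ m := by
      have := Nat.lt_floor_add_one (2 * d)
      change 2 * d < (m : ℝ) + 1 at this
      have h2 : (2 : ℕ) ≤ m := Nat.le_floor (by push_cast; linarith)
      have h2' : (2 : ℝ) ≤ m := by exact_mod_cast h2
      linarith
    obtain ⟨L, hL, hcard⟩ := Stmt5.layer_growth (m := m) hgH (by
      intro a b hab
      have h1 := hdegH a hab.2.1
      have : m < H.degree a := (Nat.floor_lt (by positivity)).2 h1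
      exact this) v (k - 1) (by omega)
    have hLS : L ⊆ S := by
      intro w hw
      obtain ⟨p, hp, hlen⟩ := hL w hw
      have hnn : ¬ p.Nil := by
        rw [← SimpleGraph.Walk.length_eq_zero_iff, hlen]; simp
      exact (SimpleGraph.Walk.adj_penultimate hnn).2.2
    have h3 : H.degree v * m ^ (k - 1) ≤ S.card := hcard.trans (Finset.card_le_card hLS)
    have h4 : (H.degree v : ℝ) * (m : ℝ) ^ (k - 1) ≤ S.card := by exact_mod_cast h3
    refine le_trans ?_ h4
    gcongr
  have hup : ∀ v ∈ S, (H.degree v : ℝ) * d ^ (k - 1) ≤ n := by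
    intro v hv
    rcases moore v hv with h | h
    · refine h.trans ?_
      exact_mod_cast Finset.card_le_univ S
    · have h1 : d ^ (k - 1) ≤ 1 := pow_le_one₀ hdpos.le h.le
      have h2 : (H.degree v : ℝ) ≤ n := by
        exact_mod_cast (H.degree_lt_card_verts v).le
      calc (H.degree v : ℝ) * d ^ (k - 1) ≤ (H.degree v : ℝ) * 1 := by gcongr
        _ ≤ n := by simpa using h2
  have hdk : d ^ k = d * d ^ (k - 1) := by
    rw [← pow_succ', Nat.sub_add_cancel (by omega)]
  have hsize : d ^ k ≤ (S.card : ℝ) := by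
    rcases moore v0 hv0 with h | h
    · refine le_trans ?_ h
      rw [hdk]
      have := hdegH v0 hv0
      gcongr
      linarith
    · have h1 : d ^ k ≤ 1 := pow_le_one₀ hdpos.le h.le
      have h2 : 1 ≤ S.card := Finset.card_pos.2 ⟨v0, hv0⟩
      have h3 : (1 : ℝ) ≤ S.card := by exact_mod_cast h2
      linarith
  obtain ⟨X, hX⟩ := Stmt5.exists_cut H
  let G' : G.Subgraph :=
    { verts := ↑S
      Adj := fun a b => H.Adj a b ∧ (a ∈ X ↔ b ∉ X)
      adj_sub := fun h => h.1.1
      edge_vert := fun h => h.1.2.1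
      symm := ⟨fun a b h => ⟨h.1.symm, by have := h.2; tauto⟩⟩ }
  have hnb : ∀ v, (G'.neighborSet v).ncard =
      (Finset.univ.filter fun w => H.Adj v w ∧ (v ∈ X ↔ w ∉ X)).card := by
    intro v
    rw [← Set.ncard_coe_finset]
    congr 1
    ext w
    simp [G', SimpleGraph.Subgraph.mem_neighborSet]
  refine ⟨G', ↑S ∩ ↑X, ↑S \ ↑X, ?_, ?_, ?_, ?_, ?_⟩
  · exact (Set.inter_union_sdiff _ _).symm
  · exact Set.disjoint_sdiff_inter.symm
  · intro a b hab
    have h1 : a ∈ S := hab.1.2.1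
    have h2 : b ∈ S := hab.1.2.2
    have h3 : a ∈ X ↔ b ∉ X := hab.2
    by_cases ha : a ∈ X
    · exact Or.inl ⟨⟨h1, ha⟩, ⟨h2, h3.1 ha⟩⟩
    · exact Or.inr ⟨⟨h1, ha⟩, ⟨h2, by by_contra hb; exact ha (h3.2 hb)⟩⟩
  · intro v hv
    have hv : v ∈ S := hv
    rw [hnb]
    constructor
    · have h1 := hdegH v hv
      have h2 : (H.degree v : ℝ) ≤
        2 * ((Finset.univ.filter fun w => H.Adj v w ∧ (v ∈ X ↔ w ∉ X)).card : ℝ) := by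
        exact_mod_cast hX v
      linarith
    · have h1 : (Finset.univ.filter fun w => H.Adj v w ∧ (v ∈ X ↔ w ∉ X)).card ≤ H.degree v := by
        rw [← SimpleGraph.card_neighborFinset_eq_degree, SimpleGraph.neighborFinset_eq_filter]
        apply Finset.card_le_card
        intro w hw
        simp only [Finset.mem_filter, Finset.mem_univ, true_and] at hw ⊢
        exact hw.1
      have h1' : ((Finset.univ.filter fun w => H.Adj v w ∧ (v ∈ X ↔ w ∉ X)).card : ℝ) ≤
        H.degree v := by exact_mod_cast h1
      refine h1'.trans ?_
      rw [le_div_iff₀ (by positivity)]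
      have h2 := hup v hv
      have hrk' : r * r ^ (k - 1) = n := by
        rw [← pow_succ', Nat.sub_add_cancel (by omega), hrk]
      rw [hd, mul_pow, ← hrk', ← mul_assoc] at h2
      exact le_of_mul_le_mul_right h2 (by positivity)
  · have : G'.verts.ncard = S.card := Set.ncard_coe_finset S
    rw [this, ← hrk, ← mul_pow]
    exact hsize
end

section
/- For every k ≥ 3 and all sufficiently large t, R(t, B_{2k}) ≤ t^{2k/(2k-1) + 4/√(log t)}, where R(t, B_{2k}) is the minimum n such that every n-vertex 3-uniform hypergraph contains a non-trivial Berge 2k-cycle or an independent set of size t. -/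
/-- A non-trivial Berge `k`-cycle in the hypergraph `H`: distinct edges
`e₁, …, e_k` of `H` such that the consecutive intersections (cyclically) admit a
system of distinct representatives and the common intersection of all the edges is
empty. -/
def HasNonTrivialBergeCycle {V : Type*} (H : Finset (Finset V)) (k : ℕ) : Prop :=
  ∃ e : Fin k → Finset V,
    (∀ i, e i ∈ H) ∧ Function.Injective e ∧
    (∃ w : Fin k → V, Function.Injective w ∧
      ∀ i : Fin k, w i ∈ e i ∧ w i ∈ e ⟨(i.val + 1) % k, Nat.mod_lt _ i.pos⟩) ∧
    (⋂ i, (e i : Set V)) = ∅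

namespace BergeAux

open Finset

/-- cyclic successor -/
def nx {m : ℕ} (i : Fin m) : Fin m := ⟨(i.val + 1) % m, Nat.mod_lt _ i.pos⟩

lemma nx_inj {m : ℕ} : Function.Injective (nx : Fin m → Fin m) := by
  intro i j h
  have h' : (i.val + 1) % m = (j.val + 1) % m := congrArg Fin.val h
  have hi := i.isLt
  have hj := j.isLt
  apply Fin.ext
  by_cases h1 : i.val + 1 = m <;> by_cases h2 : j.val + 1 = m
  · omega
  · rw [h1, Nat.mod_self, Nat.mod_eq_of_lt (by omega)] at h'; omega
  · rw [h2, Nat.mod_self, Nat.mod_eq_of_lt (by omega)] at h'; omega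
  · rw [Nat.mod_eq_of_lt (by omega), Nat.mod_eq_of_lt (by omega)] at h'; omega

lemma mk_cycle {V : Type*} {H : Finset (Finset V)} {m : ℕ} (c : Fin m → V)
    (hc : Function.Injective c) (e : Fin m → Finset V) (he : ∀ i, e i ∈ H)
    (hinj : Function.Injective e) (h1 : ∀ i, c i ∈ e i) (h2 : ∀ i, c (nx i) ∈ e i)
    (hno : ∀ x, ∃ i, x ∉ e i) : HasNonTrivialBergeCycle H m := by
  refine ⟨e, he, hinj, ⟨fun i => c (nx i), fun i j h => nx_inj (hc h), fun i => ⟨h2 i, h1 (nx i)⟩⟩, ?_⟩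
  ext x
  simp only [Set.mem_iInter, Set.mem_empty_iff_false, iff_false, not_forall]
  obtain ⟨i, hi⟩ := hno x
  exact ⟨i, by simpa using hi⟩

lemma peel {V : Type*} [DecidableEq V] (T : ℕ) (n : ℕ) : ∀ H : Finset (Finset V), H.card ≤ n →
    (∃ H' ⊆ H, H'.Nonempty ∧ ∀ e ∈ H', ∀ p ⊆ e, p.card = 2 →
      T ≤ (H'.filter (fun e' => p ⊆ e')).card) ∨
    (∃ (P : Finset (Finset V)) (φ : Finset V → Finset V),
      (∀ p ∈ P, p.card = 2 ∧ p ⊆ φ p ∧ φ p ∈ H) ∧ Set.InjOn φ P ∧ H.card ≤ T * P.card) := by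
  induction n with
  | zero =>
    intro H hH
    right
    refine ⟨∅, id, by simp, by simp, by omega⟩
  | succ n ih =>
    intro H hH
    rcases H.eq_empty_or_nonempty with rfl | hne
    · right; exact ⟨∅, id, by simp, by simp, by simp⟩
    by_cases hall : ∀ e ∈ H, ∀ p ⊆ e, p.card = 2 → T ≤ (H.filter (fun e' => p ⊆ e')).card
    · left; exact ⟨H, subset_rfl, hne, hall⟩
    push Not at hall
    obtain ⟨e, he, p, hpe, hp2, hlt⟩ := hall
    have hsplit := Finset.card_filter_add_card_filter_not (s := H) (fun e' => p ⊆ e')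
    have hpos : 0 < (H.filter (fun e' => p ⊆ e')).card :=
      Finset.card_pos.mpr ⟨e, by simp [he, hpe]⟩
    rcases ih (H.filter (fun e' => ¬ p ⊆ e')) (by omega) with ⟨H', hs, h1, h2⟩ | ⟨P, φ, h1, h2, h3⟩
    · left; exact ⟨H', hs.trans (Finset.filter_subset _ _), h1, h2⟩
    · right
      have hpP : p ∉ P := by
        intro h
        obtain ⟨_, h5, h6⟩ := h1 p h
        exact (Finset.mem_filter.mp h6).2 h5
      have hφ : ∀ q ∈ P, Function.update φ p e q = φ q := by
        intro q hq
        rw [Function.update_of_ne]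
        rintro rfl; exact hpP hq
      have hne' : ∀ q ∈ P, φ q ≠ e := by
        intro q hq h
        have := (Finset.mem_filter.mp (h1 q hq).2.2).2
        rw [h] at this; exact this hpe
      refine ⟨insert p P, Function.update φ p e, ?_, ?_, ?_⟩
      · intro q hq
        rcases Finset.mem_insert.mp hq with rfl | hq
        · simp [hp2, hpe, he]
        · rw [hφ q hq]
          exact ⟨(h1 q hq).1, (h1 q hq).2.1, (Finset.mem_filter.mp (h1 q hq).2.2).1⟩
      · intro a ha b hb hab
        rw [Finset.coe_insert] at ha hb
        rcases ha with rfl | ha <;> rcases hb with rfl | hb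
        · rfl
        · rw [hφ b hb, Function.update_self] at hab; exact absurd hab.symm (hne' b hb)
        · rw [hφ a ha, Function.update_self] at hab; exact absurd hab (hne' a ha)
        · rw [hφ a ha, hφ b hb] at hab; exact h2 ha hb hab
      · rw [Finset.card_insert_of_notMem hpP, Nat.mul_add]; omega

/-- In a heavy hypergraph, the third vertices over a pair, avoiding a given set. -/
lemma third {V : Type*} [DecidableEq V] {H : Finset (Finset V)} (hu : ∀ e ∈ H, e.card = 3)
    {T : ℕ} (p : Finset V) (hp : p.card = 2) (hT : T ≤ (H.filter (fun e' => p ⊆ e')).card)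
    (F : Finset V) (s : ℕ) (hs : F.card + s ≤ T) :
    ∃ Z : Finset V, s ≤ Z.card ∧ ∀ z ∈ Z, z ∉ F ∧ z ∉ p ∧ insert z p ∈ H := by
  let B := H.filter (fun e' => p ⊆ e')
  let Z0 := B.biUnion (fun e => e \ p)
  have hB : B.card ≤ Z0.card := by
    have hsub : B ⊆ Z0.image (fun z => insert z p) := by
      intro e he
      obtain ⟨heH, hpe⟩ := Finset.mem_filter.mp he
      have h1 : (e \ p).card = 1 := by
        rw [Finset.card_sdiff_of_subset hpe, hu e heH, hp]
      obtain ⟨z, hz⟩ := Finset.card_eq_one.mp h1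
      refine Finset.mem_image.mpr ⟨z, Finset.mem_biUnion.mpr ⟨e, he, by rw [hz]; simp⟩, ?_⟩
      rw [Finset.insert_eq, ← hz, Finset.sdiff_union_of_subset hpe]
    exact (Finset.card_le_card hsub).trans Finset.card_image_le
  refine ⟨Z0 \ F, ?_, ?_⟩
  · have := Finset.le_card_sdiff F Z0
    change T ≤ B.card at hT
    omega
  · intro z hz
    obtain ⟨hz0, hzF⟩ := Finset.mem_sdiff.mp hz
    obtain ⟨e, he, hze⟩ := Finset.mem_biUnion.mp hz0
    obtain ⟨hze, hzp⟩ := Finset.mem_sdiff.mp hze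
    obtain ⟨heH, hpe⟩ := Finset.mem_filter.mp he
    refine ⟨hzF, hzp, ?_⟩
    have : insert z p = e := by
      apply Finset.eq_of_subset_of_card_le
      · intro y hy
        rcases Finset.mem_insert.mp hy with rfl | hy
        · exact hze
        · exact hpe hy
      · rw [hu e heH, Finset.card_insert_of_notMem hzp, hp]
    rw [this]; exact heH

lemma heavy_path {V : Type*} [DecidableEq V] {H : Finset (Finset V)} (hu : ∀ e ∈ H, e.card = 3)
    (hne : H.Nonempty) {T : ℕ}
    (hT : ∀ e ∈ H, ∀ p ⊆ e, p.card = 2 → T ≤ (H.filter (fun e' => p ⊆ e')).card) :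
    ∃ v : V, ∀ n, n + 3 ≤ T → ∃ (c : ℕ → V), (∀ i ≤ n, c i ≠ v) ∧
      (∀ i ≤ n, ∀ j ≤ n, c i = c j → i = j) ∧
      (∀ i ≤ n, ∃ e ∈ H, v ∈ e ∧ c i ∈ e) ∧
      (∀ i < n, ∃ e ∈ H, c i ∈ e ∧ c (i+1) ∈ e) := by
  obtain ⟨e, he⟩ := hne
  obtain ⟨v, x, y, hvx, hvy, hxy, rfl⟩ := Finset.card_eq_three.mp (hu e he)
  refine ⟨v, ?_⟩
  intro n
  induction n with
  | zero =>
    intro _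
    refine ⟨fun _ => x, fun i _ => hvx.symm, fun i hi j hj _ => by omega,
      fun i _ => ⟨_, he, by simp, by simp⟩, fun i hi => by omega⟩
  | succ n ih =>
    intro hn
    obtain ⟨c, h1, h2, h3, h4⟩ := ih (by omega)
    obtain ⟨e', he', hv', hc'⟩ := h3 n le_rfl
    have hp : ({v, c n} : Finset V).card = 2 := Finset.card_pair (h1 n le_rfl).symm
    have hsub : ({v, c n} : Finset V) ⊆ e' := by
      intro z hz; simp only [Finset.mem_insert, Finset.mem_singleton] at hz
      rcases hz with rfl | rfl <;> assumption
    obtain ⟨Z, hZ, hz⟩ := third hu _ hp (hT e' he' _ hsub hp)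
      ((Finset.range (n+1)).image c) 1 (by
        have := Finset.card_image_le (s := Finset.range (n+1)) (f := c)
        rw [Finset.card_range] at this; omega)
    obtain ⟨z, hzZ⟩ := Finset.card_pos.mp (by omega : 0 < Z.card)
    obtain ⟨hzF, hzp, hzH⟩ := hz z hzZ
    simp only [Finset.mem_image, Finset.mem_range, not_exists, not_and] at hzF
    simp only [Finset.mem_insert, Finset.mem_singleton, not_or] at hzp
    refine ⟨fun i => if i ≤ n then c i else z, ?_, ?_, ?_, ?_⟩
    · intro i hi
      by_cases h : i ≤ n
      · simpa [h] using h1 i h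
      · simpa [h] using hzp.1
    · intro i hi j hj hij
      by_cases h : i ≤ n <;> by_cases h' : j ≤ n
      · simp only [h, h', if_true] at hij; exact h2 i h j h' hij
      · simp only [h, h', if_true, if_false] at hij; exact absurd hij (hzF i (by omega))
      · simp only [h, h', if_true, if_false] at hij; exact absurd hij.symm (hzF j (by omega))
      · omega
    · intro i hi
      by_cases h : i ≤ n
      · simpa [h] using h3 i h
      · simp only [h, if_false]; exact ⟨_, hzH, by simp, by simp⟩
    · intro i hi
      by_cases h : i + 1 ≤ n
      · have h' : i ≤ n := by omega
        simpa [h, h'] using h4 i (by omega)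
      · have h' : i = n := by omega
        subst h'
        simp only [le_refl, if_true, h, if_false]; exact ⟨_, hzH, by simp, by simp⟩

lemma heavy_cycle {V : Type*} [DecidableEq V] {H : Finset (Finset V)} (hu : ∀ e ∈ H, e.card = 3)
    (hne : H.Nonempty) {k : ℕ} (hk : 3 ≤ k)
    (hT : ∀ e ∈ H, ∀ p ⊆ e, p.card = 2 → 6 * k ≤ (H.filter (fun e' => p ⊆ e')).card) :
    HasNonTrivialBergeCycle H (2 * k) := by
  obtain ⟨v, hv⟩ := heavy_path hu hne hT
  obtain ⟨c0, h1, h2, h3, h4⟩ := hv (2 * k - 2) (by omega)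
  let c : Fin (2 * k) → V := fun i => if i.val = 0 then v else c0 (i.val - 1)
  have hc : Function.Injective c := by
    intro i j hij
    have hi := i.isLt
    have hj := j.isLt
    apply Fin.ext
    by_cases h : i.val = 0 <;> by_cases h' : j.val = 0 <;> simp only [c, h, h', if_true, if_false] at hij
    · omega
    · exact absurd hij.symm (h1 _ (by omega))
    · exact absurd hij (h1 _ (by omega))
    · have := h2 _ (by omega) _ (by omega) hij; omega
  have hedge : ∀ i, ∃ e ∈ H, c i ∈ e ∧ c (nx i) ∈ e := by
    intro i
    have hi := i.isLt
    by_cases hl : i.val + 1 = 2 * k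
    · have hz : (nx i).val = 0 := by simp [nx, hl]
      have h0 : ¬ (i.val = 0) := by omega
      simp only [c, hz, h0, if_true, if_false]
      obtain ⟨e, he, a, b⟩ := h3 (i.val - 1) (by omega)
      exact ⟨e, he, b, a⟩
    · have hz : (nx i).val = i.val + 1 := Nat.mod_eq_of_lt (by omega)
      by_cases h0 : i.val = 0
      · simp only [c, hz, h0, if_true]
        simpa using h3 0 (by omega)
      · have := h4 (i.val - 1) (by omega)
        simp only [c, hz, h0, if_false]
        rw [Nat.sub_add_cancel (by omega)] at this
        simpa using this
  have hnx : ∀ i : Fin (2 * k), c i ≠ c (nx i) := by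
    intro i h
    have h := congrArg Fin.val (hc h)
    have hi := i.isLt
    by_cases hl : i.val + 1 = 2 * k
    · have hz : (nx i).val = 0 := by simp [nx, hl]
      omega
    · have hz : (nx i).val = i.val + 1 := Nat.mod_eq_of_lt (by omega)
      omega
  have hZ : ∀ i, ∃ Z : Finset V, 2 * k ≤ Z.card ∧ ∀ z ∈ Z, z ∉ Finset.univ.image c ∧
      insert z {c i, c (nx i)} ∈ H := by
    intro i
    obtain ⟨e, he, ha, hb⟩ := hedge i
    have hp : ({c i, c (nx i)} : Finset V).card = 2 := Finset.card_pair (hnx i)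
    have hsub : ({c i, c (nx i)} : Finset V) ⊆ e := by
      intro z hz; simp only [Finset.mem_insert, Finset.mem_singleton] at hz
      rcases hz with rfl | rfl <;> assumption
    obtain ⟨Z, hZ, hz⟩ := third hu _ hp (hT e he _ hsub hp) (Finset.univ.image c) (2 * k) (by
      have := Finset.card_image_le (s := Finset.univ) (f := c)
      rw [Finset.card_univ, Fintype.card_fin] at this; omega)
    exact ⟨Z, hZ, fun z hzZ => ⟨(hz z hzZ).1, (hz z hzZ).2.2⟩⟩
  choose Z hZc hZ using hZ
  obtain ⟨z, hzinj, hz⟩ := (Finset.all_card_le_biUnion_card_iff_exists_injective Z).mp (by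
    intro s
    rcases s.eq_empty_or_nonempty with rfl | ⟨i, hi⟩
    · simp
    · have h1 : s.card ≤ 2 * k := by simpa using Finset.card_le_univ s
      exact h1.trans ((hZc i).trans (Finset.card_le_card (Finset.subset_biUnion_of_mem Z hi))))
  have hzc : ∀ i j, z i ≠ c j := by
    intro i j h
    exact (hZ i _ (hz i)).1 (by rw [h]; simp)
  have key : ∀ i j, z i ∈ (insert (z j) {c j, c (nx j)} : Finset V) → i = j := by
    intro i j h
    simp only [Finset.mem_insert, Finset.mem_singleton] at h
    rcases h with h | h | h
    · exact hzinj h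
    · exact absurd h (hzc _ _)
    · exact absurd h (hzc _ _)
  refine mk_cycle c hc (fun i => insert (z i) {c i, c (nx i)}) (fun i => (hZ i _ (hz i)).2) ?_
    (by simp) (by simp) ?_
  · intro i j hij
    apply key
    rw [← (show insert (z i) {c i, c (nx i)} = insert (z j) {c j, c (nx j)} from hij)]; simp
  · intro x
    by_contra hcon
    push Not at hcon
    have a0 := hcon ⟨0, by omega⟩
    have a2 := hcon ⟨2, by omega⟩
    have e0 : nx (⟨0, by omega⟩ : Fin (2 * k)) = ⟨1, by omega⟩ := by
      apply Fin.ext; exact Nat.mod_eq_of_lt (by simp; omega)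
    have e2 : nx (⟨2, by omega⟩ : Fin (2 * k)) = ⟨3, by omega⟩ := by
      apply Fin.ext; exact Nat.mod_eq_of_lt (by simp; omega)
    rw [e0] at a0
    rw [e2] at a2
    simp only [Finset.mem_insert, Finset.mem_singleton] at a0 a2
    rcases a0 with h | h | h <;> rcases a2 with h' | h' | h' <;> rw [h] at h'
    all_goals first
      | exact absurd h' (hzc _ _)
      | exact absurd h'.symm (hzc _ _)
      | (have := congrArg Fin.val (hc h'); simp at this)
      | (have := congrArg Fin.val (hzinj h'); simp at this)

/-- vertex deletion -/
lemma deletion {V : Type*} [DecidableEq V] (H : Finset (Finset V)) (Q s : ℕ) (n : ℕ) :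
    ∀ U : Finset V, U.card = s + n →
    (∃ U' ⊆ U, s < U'.card ∧ ∀ v ∈ U',
      (H.filter (fun e => e ⊆ U' ∧ v ∈ e)).card * U'.card < Q * (H.filter (fun e => e ⊆ U')).card) ∨
    (∃ U' ⊆ U, U'.card = s ∧ ((H.filter (fun e => e ⊆ U')).card : ℝ) * (U.card : ℝ) ^ Q ≤
      ((H.filter (fun e => e ⊆ U)).card : ℝ) * (s : ℝ) ^ Q) := by
  induction n with
  | zero =>
    intro U hU
    right
    exact ⟨U, subset_rfl, by omega, by rw [hU]; simp⟩
  | succ n ih =>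
    intro U hU
    by_cases hall : ∀ v ∈ U, (H.filter (fun e => e ⊆ U ∧ v ∈ e)).card * U.card
        < Q * (H.filter (fun e => e ⊆ U)).card
    · left; exact ⟨U, subset_rfl, by omega, hall⟩
    push Not at hall
    obtain ⟨v, hv, hge⟩ := hall
    have hcard : (U.erase v).card = s + n := by rw [Finset.card_erase_of_mem hv]; omega
    rcases ih (U.erase v) hcard with ⟨U', h1, h2, h3⟩ | ⟨U', h1, h2, h3⟩
    · left; exact ⟨U', h1.trans (Finset.erase_subset _ _), h2, h3⟩
    right
    refine ⟨U', h1.trans (Finset.erase_subset _ _), h2, ?_⟩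
    have hsplit : (H.filter (fun e => e ⊆ U ∧ v ∈ e)).card +
        (H.filter (fun e => e ⊆ U.erase v)).card = (H.filter (fun e => e ⊆ U)).card := by
      have := Finset.card_filter_add_card_filter_not (s := H.filter (fun e => e ⊆ U)) (fun e => v ∈ e)
      rw [Finset.filter_filter, Finset.filter_filter] at this
      rw [← this]
      congr 2
      apply Finset.filter_congr
      intro e _
      rw [Finset.subset_erase]
    set m : ℝ := (U.card : ℝ) with hm
    have hmc : ((U.erase v).card : ℝ) = m - 1 := by rw [hcard, hm, hU]; push_cast; ring
    rw [hmc] at h3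
    set a : ℝ := ((H.filter (fun e => e ⊆ U)).card : ℝ) with ha
    set b : ℝ := ((H.filter (fun e => e ⊆ U.erase v)).card : ℝ) with hb
    set d : ℝ := ((H.filter (fun e => e ⊆ U ∧ v ∈ e)).card : ℝ) with hd
    set x : ℝ := ((H.filter (fun e => e ⊆ U')).card : ℝ) with hx
    have hs' : d + b = a := by rw [ha, ← hsplit]; push_cast; rfl
    have hge' : (Q : ℝ) * a ≤ d * m := by rw [ha, hd, hm]; exact_mod_cast hge
    have hm1 : 1 ≤ m := by rw [hm, hU]; push_cast; have : (0:ℝ) ≤ s := by positivity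
                           have : (0:ℝ) ≤ n := by positivity
                           linarith
    have ha0 : 0 ≤ a := by positivity
    have hb0 : 0 ≤ b := by positivity
    have hx0 : 0 ≤ x := by positivity
    -- b * m^Q ≤ a * (m-1)^Q
    have hmono : x ≤ b := by
      rw [hx, hb]
      have hsub : H.filter (fun e => e ⊆ U') ⊆ H.filter (fun e => e ⊆ U.erase v) := by
        intro e he
        obtain ⟨he1, he2⟩ := Finset.mem_filter.mp he
        exact Finset.mem_filter.mpr ⟨he1, he2.trans h1⟩
      exact_mod_cast Finset.card_le_card hsub
    have hbern : 1 + (Q:ℝ) * (-(1/m)) ≤ (1 + (-(1/m))) ^ Q := by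
      apply one_add_mul_le_pow
      have : 1 / m ≤ 1 := by rw [div_le_one (by linarith)]; exact hm1
      linarith
    have hb1 : b ≤ a * (1 + (-(1/m))) ^ Q := by
      refine le_trans ?_ (mul_le_mul_of_nonneg_left hbern ha0)
      have : (Q:ℝ) * a / m ≤ d := by rw [div_le_iff₀ (by linarith)]; exact hge'
      have e1 : a * (1 + (Q:ℝ) * (-(1/m))) = a - (Q:ℝ) * a / m := by ring
      rw [e1]; linarith
    have hb2 : b * m ^ Q ≤ a * (m - 1) ^ Q := by
      calc b * m ^ Q ≤ a * (1 + (-(1/m))) ^ Q * m ^ Q := by gcongr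
        _ = a * ((1 + (-(1/m))) * m) ^ Q := by rw [mul_pow]; ring
        _ = a * (m - 1) ^ Q := by
          congr 2; field_simp; ring
    rcases eq_or_lt_of_le hm1 with h | h
    · -- m = 1
      have hs0 : s = 0 ∧ n = 0 := by
        rw [hm, hU] at h
        have : s + (n + 1) = 1 := by exact_mod_cast h.symm
        omega
      obtain ⟨rfl, rfl⟩ := hs0
      have hh : m - 1 = 0 := by linarith
      rw [hh] at hb2
      calc x * m ^ Q ≤ b * m ^ Q := by gcongr
        _ ≤ _ := by simpa using hb2
    · have hp : 0 < (m - 1) ^ Q := by apply pow_pos; linarith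
      have hmp : 0 < m ^ Q := by apply pow_pos; linarith
      have : (x * m ^ Q) * (m - 1) ^ Q ≤ (a * (s:ℝ) ^ Q) * (m - 1) ^ Q := by
        calc (x * m ^ Q) * (m - 1) ^ Q = (x * (m - 1) ^ Q) * m ^ Q := by ring
          _ ≤ (b * (s:ℝ) ^ Q) * m ^ Q := by gcongr
          _ = (b * m ^ Q) * (s:ℝ) ^ Q := by ring
          _ ≤ (a * (m - 1) ^ Q) * (s:ℝ) ^ Q := by gcongr
          _ = _ := by ring
      exact le_of_mul_le_mul_right this hp

lemma sum_deg {V : Type*} [DecidableEq V] (H : Finset (Finset V)) (hu : ∀ e ∈ H, e.card = 3)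
    (U : Finset V) : ∑ v ∈ U, (H.filter (fun e => e ⊆ U ∧ v ∈ e)).card
      = 3 * (H.filter (fun e => e ⊆ U)).card := by
  have h := Finset.sum_card_bipartiteAbove_eq_sum_card_bipartiteBelow (s := U)
    (t := H.filter (fun e => e ⊆ U)) (fun v e => v ∈ e)
  simp only [Finset.bipartiteAbove, Finset.bipartiteBelow, Finset.filter_filter] at h
  rw [h, Finset.sum_const_nat (m := 3), mul_comm]
  intro e he
  obtain ⟨he, hs⟩ := Finset.mem_filter.mp he
  rw [Finset.filter_mem_eq_inter, Finset.inter_eq_right.mpr hs, hu e he]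

/-- independent sets -/
lemma indep {V : Type*} [DecidableEq V] (H : Finset (Finset V)) (hu : ∀ e ∈ H, e.card = 3)
    (U : Finset V) (t : ℕ) (h2t : 2 * t ≤ U.card)
    (he : 8 * ((H.filter (fun e => e ⊆ U)).card : ℝ) * (t : ℝ) ^ 2 ≤ (U.card : ℝ) ^ 3) :
    ∃ I : Finset V, I.card = t ∧ ∀ e ∈ H, ¬ e ⊆ I := by
  rcases Nat.eq_zero_or_pos t with rfl | ht
  · refine ⟨∅, rfl, fun e he h => ?_⟩
    have := hu e he
    rw [Finset.subset_empty.mp h] at this; simp at this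
  obtain ⟨n, hn⟩ := Nat.exists_eq_add_of_le h2t
  rcases deletion H 3 (2 * t) n U hn with ⟨U', _, h2, h3⟩ | ⟨U', _, h2, h3⟩
  · exfalso
    have h4 := sum_deg H hu U'
    have hne : U'.Nonempty := Finset.card_pos.mp (by omega)
    have h5 := Finset.sum_lt_sum_of_nonempty hne h3
    rw [← Finset.sum_mul, h4, Finset.sum_const, smul_eq_mul, mul_comm] at h5
    exact lt_irrefl _ h5
  · set x := (H.filter (fun e => e ⊆ U')).card with hx
    have hx : x ≤ t := by
      have hm : (0:ℝ) < (U.card : ℝ) ^ 3 := by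
        apply pow_pos; exact_mod_cast (by omega : 0 < U.card)
      have : (x:ℝ) * (U.card : ℝ) ^ 3 ≤ t * (U.card : ℝ) ^ 3 := by
        refine h3.trans ?_
        push_cast
        calc _ = t * (8 * ((H.filter (fun e => e ⊆ U)).card : ℝ) * (t : ℝ) ^ 2) := by ring
          _ ≤ _ := by gcongr
      exact_mod_cast le_of_mul_le_mul_right this hm
    let g : Finset V → Finset V := fun e => if h : e.Nonempty then {h.choose} else ∅
    let D := (H.filter (fun e => e ⊆ U')).biUnion g
    have hD : D.card ≤ x * 1 := by
      apply Finset.card_biUnion_le_card_mul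
      intro e _
      by_cases h : e.Nonempty <;> simp [g, h]
    have hc : t ≤ (U' \ D).card := by
      have := Finset.le_card_sdiff D U'
      omega
    obtain ⟨I, hI, hIc⟩ := Finset.exists_subset_card_eq hc
    refine ⟨I, hIc, fun e he hsub => ?_⟩
    have hen : e.Nonempty := Finset.card_pos.mp (by rw [hu e he]; norm_num)
    have h6 := hsub.trans hI
    have h7 : hen.choose ∈ D := by
      refine Finset.mem_biUnion.mpr ⟨e, ?_, by simp [g, hen]⟩
      exact Finset.mem_filter.mpr ⟨he, h6.trans Finset.sdiff_subset⟩
    exact (Finset.mem_sdiff.mp (h6 hen.choose_spec)).2 h7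

section matrices

lemma ratio_mono {u : ℕ → ℝ} (hpos : ∀ l, 0 < u l) (hlc : ∀ l, u (l+1) ^ 2 ≤ u l * u (l+2)) :
    Monotone (fun l => u (l+1) / u l) := by
  apply monotone_nat_of_le_succ
  intro l
  change u (l+1) / u l ≤ u (l+2) / u (l+1)
  rw [div_le_div_iff₀ (hpos _) (hpos _)]
  have := hlc l
  nlinarith

lemma logconvex {u : ℕ → ℝ} (hpos : ∀ l, 0 < u l) (hlc : ∀ l, u (l+1) ^ 2 ≤ u l * u (l+2))
    (a b : ℕ) : u (a+1) * u (b+1) ≤ u 1 * u (a+b+1) := by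
  induction a with
  | zero => simp
  | succ a ih =>
    have hr := ratio_mono hpos hlc (show a + 1 ≤ a + b + 1 by omega)
    simp only at hr
    have e1 : u (a+1+1) = u (a+1+1) / u (a+1) * u (a+1) := by
      field_simp [(hpos (a+1)).ne']
    have e2 : u (a+b+1+1) = u (a+b+1+1) / u (a+b+1) * u (a+b+1) := by
      field_simp [(hpos (a+b+1)).ne']
    have e3 : a + 1 + b + 1 = a + b + 1 + 1 := by ring
    have h0 : 0 < u (a+1+1) / u (a+1) := div_pos (hpos _) (hpos _)
    calc u (a+1+1) * u (b+1) = u (a+1+1) / u (a+1) * (u (a+1) * u (b+1)) := by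
          conv_lhs => rw [e1]
          ring
      _ ≤ u (a+1+1) / u (a+1) * (u 1 * u (a+b+1)) := by gcongr
      _ ≤ u (a+b+1+1) / u (a+b+1) * (u 1 * u (a+b+1)) := by
          have := hpos 1
          have := hpos (a+b+1)
          gcongr
      _ = u 1 * u (a+1+b+1) := by
          rw [e3]; conv_rhs => rw [e2]
          ring

lemma ratio_last {u : ℕ → ℝ} (hpos : ∀ l, 0 < u l) (hlc : ∀ l, u (l+1) ^ 2 ≤ u l * u (l+2))
    (R : ℝ) (j : ℕ) (h : R ^ (j+1) * u 0 ≤ u (j+1)) : R * u j ≤ u (j+1) := by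
  by_contra hcon
  push Not at hcon
  have hR : u (j+1) / u j < R := by rw [div_lt_iff₀ (hpos _)]; exact hcon
  have hR0 : 0 < R := (div_pos (hpos _) (hpos _)).trans hR
  have key : ∀ l ≤ j, u (l+1) < R ^ (l+1) * u 0 := by
    intro l
    induction l with
    | zero =>
      intro _
      have := (ratio_mono hpos hlc (Nat.zero_le j)).trans_lt hR
      simp only [zero_add] at this
      rw [div_lt_iff₀ (hpos _)] at this
      simpa using this
    | succ l ih =>
      intro hl
      have h1 := ih (by omega)
      have := (ratio_mono hpos hlc hl).trans_lt hR
      simp only at this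
      rw [div_lt_iff₀ (hpos _)] at this
      calc _ < R * u (l+1) := this
        _ < R * (R ^ (l+1) * u 0) := by gcongr
        _ = _ := by ring
  exact absurd h (not_le.mpr (key j le_rfl))

variable {W : Type*} [Fintype W] [DecidableEq W]

lemma pow_symm {A : Matrix W W ℝ} (hA : A.IsSymm) (l : ℕ) (x y : W) : (A ^ l) x y = (A ^ l) y x := by
  have : (A ^ l).IsSymm := hA.pow l
  exact this.apply y x

lemma pow_nonneg' {A : Matrix W W ℝ} (hA : ∀ x y, 0 ≤ A x y) (l : ℕ) (x y : W) :
    0 ≤ (A ^ l) x y := by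
  induction l generalizing x y with
  | zero => rw [pow_zero, Matrix.one_apply]; split_ifs <;> norm_num
  | succ l ih =>
    rw [pow_succ, Matrix.mul_apply]
    exact Finset.sum_nonneg fun z _ => mul_nonneg (ih _ _) (hA _ _)

lemma diag_eq {A : Matrix W W ℝ} (hA : A.IsSymm) (l : ℕ) (x : W) :
    (A ^ (2 * l)) x x = ∑ y, (A ^ l) x y ^ 2 := by
  rw [two_mul, pow_add, Matrix.mul_apply]
  refine Finset.sum_congr rfl fun y _ => ?_
  rw [pow_symm hA l y x, sq]

lemma diag_cs {A : Matrix W W ℝ} (hA : A.IsSymm) (a b : ℕ) (x : W) :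
    (A ^ (a + b)) x x ^ 2 ≤ (A ^ (2 * a)) x x * (A ^ (2 * b)) x x := by
  rw [diag_eq hA a, diag_eq hA b, pow_add, Matrix.mul_apply]
  have := Finset.sum_mul_sq_le_sq_mul_sq Finset.univ (fun y => (A ^ a) x y) (fun y => (A ^ b) x y)
  refine le_trans (le_of_eq ?_) this
  congr 1
  exact Finset.sum_congr rfl fun y _ => by rw [pow_symm hA b y x]

lemma diag_lc {A : Matrix W W ℝ} (hA : A.IsSymm) (x : W) (l : ℕ) :
    (A ^ (2 * (l + 1))) x x ^ 2 ≤ (A ^ (2 * l)) x x * (A ^ (2 * (l + 2))) x x := by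
  have := diag_cs hA l (l + 2) x
  rwa [show l + (l + 2) = 2 * (l + 1) by ring] at this

lemma diag_pos {A : Matrix W W ℝ} (hA : A.IsSymm) (x : W)
    (h1 : 0 < (A ^ 2) x x) (l : ℕ) : 0 < (A ^ (2 * l)) x x := by
  have key : ∀ l, 0 < (A ^ (2 * l)) x x ∧ 0 < (A ^ (2 * (l + 1))) x x := by
    intro l
    induction l with
    | zero => simpa using h1
    | succ l ih =>
      refine ⟨ih.2, ?_⟩
      have h := diag_lc hA x l
      have h2 : 0 < (A ^ (2 * (l + 1))) x x ^ 2 := pow_pos ih.2 2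
      exact pos_of_mul_pos_right (h2.trans_le h) ih.1.le
  exact (key l).1

/-- the product of two closed walk counts -/
lemma two_closed {A : Matrix W W ℝ} (hA : A.IsSymm) (x : W)
    (h0 : A x x = 0) (h1 : 0 < (A ^ 2) x x) (k j : ℕ) (hk : 2 ≤ k) (hj : 1 ≤ j) (hj2 : j + 1 ≤ 2 * k) :
    (A ^ j) x x * (A ^ (2 * k - j)) x x ≤ (A ^ 2) x x * (A ^ (2 * (k - 1))) x x := by
  have hpos := diag_pos hA x h1
  have hr : 0 ≤ (A ^ 2) x x * (A ^ (2 * (k - 1))) x x := mul_nonneg h1.le (hpos _).le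
  by_cases e1 : j = 1
  · subst e1; rw [pow_one, h0, zero_mul]; exact hr
  by_cases e2 : j + 1 = 2 * k
  · rw [show 2 * k - j = 1 by omega, pow_one, h0, mul_zero]; exact hr
  have hlc := logconvex (u := fun l => (A ^ (2 * l)) x x) hpos (diag_lc hA x)
  obtain ⟨p, q, hp, hq, hpq, hpq'⟩ : ∃ p q : ℕ, 1 ≤ p ∧ 1 ≤ q ∧ j = p + q ∧ (q = p ∨ q = p + 1) :=
    ⟨j / 2, j - j / 2, by omega, by omega, by omega, by omega⟩
  obtain ⟨r, s, hr1, hs1, hrs, hps, hqr⟩ : ∃ r s : ℕ, 1 ≤ r ∧ 1 ≤ s ∧ 2 * k - j = r + s ∧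
      p + s = k ∧ q + r = k :=
    ⟨k - q, k - p, by omega, by omega, by omega, by omega, by omega⟩
  have c1 := diag_cs hA p q x
  have c2 := diag_cs hA r s x
  rw [hrs, hpq]
  have l1 := hlc (p - 1) (s - 1)
  have l2 := hlc (q - 1) (r - 1)
  simp only [mul_one] at l1 l2
  rw [Nat.sub_add_cancel hp, Nat.sub_add_cancel hs1, show p - 1 + (s - 1) + 1 = k - 1 by omega] at l1
  rw [Nat.sub_add_cancel hq, Nat.sub_add_cancel hr1, show q - 1 + (r - 1) + 1 = k - 1 by omega] at l2
  apply le_of_sq_le_sq ?_ hr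
  set M := (A ^ 2) x x * (A ^ (2 * (k - 1))) x x
  calc ((A ^ (p + q)) x x * (A ^ (r + s)) x x) ^ 2
      = (A ^ (p + q)) x x ^ 2 * (A ^ (r + s)) x x ^ 2 := by ring
    _ ≤ ((A ^ (2 * p)) x x * (A ^ (2 * q)) x x) * ((A ^ (2 * r)) x x * (A ^ (2 * s)) x x) := by
        have := hpos p
        have := hpos q
        gcongr
    _ = ((A ^ (2 * p)) x x * (A ^ (2 * s)) x x) * ((A ^ (2 * q)) x x * (A ^ (2 * r)) x x) := by ring
    _ ≤ M * M := by
        have := hpos q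
        have := hpos r
        gcongr
    _ = M ^ 2 := by ring

/-- closed walk count -/
noncomputable def hh (A : Matrix W W ℝ) (l : ℕ) : ℝ := ∑ x, (A ^ (2 * l)) x x

lemma hh_lc {A : Matrix W W ℝ} (hA : A.IsSymm) (hn : ∀ x y, 0 ≤ A x y) (l : ℕ) :
    hh A (l + 1) ^ 2 ≤ hh A l * hh A (l + 2) := by
  apply Finset.sum_sq_le_sum_mul_sum_of_sq_le_mul
  · intro x _; exact pow_nonneg' hn _ _ _
  · intro x _; exact pow_nonneg' hn _ _ _
  · intro x _; exact diag_lc hA x l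

lemma hh_lower [Nonempty W] {A : Matrix W W ℝ} (hA : A.IsSymm) (hn : ∀ x y, 0 ≤ A x y) (δ : ℝ)
    (hδ0 : 0 ≤ δ) (hδ : ∀ x, δ ≤ ∑ y, A x y) (l : ℕ) : δ ^ (2 * l) ≤ hh A l := by
  have hrow : ∀ l x, δ ^ l ≤ ∑ y, (A ^ l) x y := by
    intro l
    induction l with
    | zero => intro x; simp [Matrix.one_apply]
    | succ l ih =>
      intro x
      calc δ ^ (l+1) = δ ^ l * δ := pow_succ _ _
        _ ≤ (∑ z, (A ^ l) x z) * δ := by gcongr; exact ih x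
        _ = ∑ z, (A ^ l) x z * δ := Finset.sum_mul _ _ _
        _ ≤ ∑ z, (A ^ l) x z * ∑ y, A z y := by
            apply Finset.sum_le_sum
            intro z _
            exact mul_le_mul_of_nonneg_left (hδ z) (pow_nonneg' hn _ _ _)
        _ = ∑ z, ∑ y, (A ^ l) x z * A z y := by simp_rw [Finset.mul_sum]
        _ = ∑ y, ∑ z, (A ^ l) x z * A z y := Finset.sum_comm
        _ = _ := by simp_rw [pow_succ, Matrix.mul_apply]
  have hN : (0:ℝ) < Fintype.card W := by exact_mod_cast Fintype.card_pos
  have hx : ∀ x, δ ^ (2 * l) ≤ Fintype.card W * (A ^ (2 * l)) x x := by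
    intro x
    rw [diag_eq hA]
    calc δ ^ (2 * l) = (δ ^ l) ^ 2 := by ring
      _ ≤ (∑ y, (A ^ l) x y) ^ 2 := by gcongr; exact hrow l x
      _ ≤ _ := by
        have := sq_sum_le_card_mul_sum_sq (s := (Finset.univ : Finset W)) (f := fun y => (A ^ l) x y)
        simpa using this
  have hsum : ∑ _x : W, δ ^ (2 * l) ≤ ∑ x, Fintype.card W * (A ^ (2 * l)) x x :=
    Finset.sum_le_sum fun x _ => hx x
  rw [Finset.sum_const, Finset.card_univ, nsmul_eq_mul, ← Finset.mul_sum] at hsum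
  exact le_of_mul_le_mul_left hsum hN

end matrices

section walks

variable {W : Type*} [Fintype W] [DecidableEq W]

/-- walks of length `l` from `x` to `y`, as vertex lists without the last vertex -/
def wk (adj : W → W → Prop) [DecidableRel adj] : ℕ → W → W → Finset (List W)
  | 0, x, y => if x = y then {[]} else ∅
  | l + 1, x, y => (Finset.univ.filter (fun z => adj x z)).biUnion
      (fun z => (wk adj l z y).image (List.cons x))

variable {adj : W → W → Prop} [DecidableRel adj]

lemma mem_wk_zero {x y : W} {L : List W} : L ∈ wk adj 0 x y ↔ L = [] ∧ x = y := by
  by_cases h : x = y <;> simp [wk, h]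

lemma mem_wk_succ {l : ℕ} {x y : W} {L : List W} : L ∈ wk adj (l+1) x y ↔
    ∃ z L', adj x z ∧ L' ∈ wk adj l z y ∧ L = x :: L' := by
  simp only [wk, Finset.mem_biUnion, Finset.mem_filter, Finset.mem_univ, true_and,
    Finset.mem_image]
  constructor
  · rintro ⟨z, hz, L', hL', rfl⟩; exact ⟨z, L', hz, hL', rfl⟩
  · rintro ⟨z, L', hz, hL', rfl⟩; exact ⟨z, hz, L', hL', rfl⟩

lemma wk_length {l : ℕ} {x y : W} {L : List W} (h : L ∈ wk adj l x y) : L.length = l := by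
  induction l generalizing x L with
  | zero => rw [(mem_wk_zero.mp h).1]; rfl
  | succ l ih =>
    obtain ⟨z, L', _, h', rfl⟩ := mem_wk_succ.mp h
    simp [ih h']

lemma wk_head {l : ℕ} {x y : W} {L : List W} (h : L ∈ wk adj l x y) :
    (L ++ [y])[0]? = some x := by
  cases l with
  | zero => obtain ⟨rfl, rfl⟩ := mem_wk_zero.mp h; simp
  | succ l =>
    obtain ⟨z, L', _, h', rfl⟩ := mem_wk_succ.mp h
    simp

lemma wk_adj {l : ℕ} {x y : W} {L : List W} (h : L ∈ wk adj l x y) (i : ℕ) (hi : i < l) :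
    ∃ u v, (L ++ [y])[i]? = some u ∧ (L ++ [y])[i+1]? = some v ∧ adj u v := by
  induction l generalizing x L i with
  | zero => omega
  | succ l ih =>
    obtain ⟨z, L', hz, h', rfl⟩ := mem_wk_succ.mp h
    cases i with
    | zero => exact ⟨x, z, by simp, by simpa using wk_head h', hz⟩
    | succ i =>
      obtain ⟨u, v, h1, h2, h3⟩ := ih h' i (by omega)
      exact ⟨u, v, by simpa using h1, by simpa using h2, h3⟩

lemma wk_append {a b : ℕ} {x y z : W} {L M : List W} (h : L ∈ wk adj a x z)
    (h' : M ∈ wk adj b z y) : L ++ M ∈ wk adj (a + b) x y := by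
  induction a generalizing x L with
  | zero => obtain ⟨rfl, rfl⟩ := mem_wk_zero.mp h; simpa using h'
  | succ a ih =>
    obtain ⟨w, L', hz, hL, rfl⟩ := mem_wk_succ.mp h
    rw [show a + 1 + b = (a + b) + 1 by ring]
    exact mem_wk_succ.mpr ⟨w, L' ++ M, hz, ih hL, rfl⟩

lemma wk_split {a b : ℕ} {x y : W} {L : List W} (h : L ∈ wk adj (a + b) x y) :
    ∃ z, L.take a ∈ wk adj a x z ∧ L.drop a ∈ wk adj b z y := by
  induction a generalizing x L with
  | zero => exact ⟨x, by simp [mem_wk_zero], by simpa using h⟩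
  | succ a ih =>
    rw [show a + 1 + b = (a + b) + 1 by ring] at h
    obtain ⟨w, L', hz, hL, rfl⟩ := mem_wk_succ.mp h
    obtain ⟨z, h1, h2⟩ := ih hL
    exact ⟨z, mem_wk_succ.mpr ⟨w, _, hz, h1, by simp⟩, by simpa using h2⟩

/-- the vertex at the split point -/
lemma wk_split' {m i : ℕ} {x y : W} {L : List W} (h : L ∈ wk adj m x y) (hi : i < m) (z : W)
    (hz : L[i]? = some z) : L.take i ∈ wk adj i x z ∧ L.drop i ∈ wk adj (m - i) z y := by
  have h' : L ∈ wk adj (i + (m - i)) x y := by rwa [Nat.add_sub_cancel' hi.le]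
  obtain ⟨w, h1, h2⟩ := wk_split h'
  have h3 := wk_head h2
  have hl := wk_length h
  rw [List.getElem?_append_left (by simp; omega)] at h3
  simp only [List.getElem?_drop, add_zero] at h3
  rw [hz] at h3
  obtain rfl := Option.some.inj h3
  exact ⟨h1, h2⟩

lemma wk_degenerate {m i j : ℕ} {x z : W} {L : List W} (h : L ∈ wk adj m x x) (hij : i < j) (hj : j < m)
    (hi : L[i]? = some z) (hj' : L[j]? = some z) :
    ∃ p ∈ wk adj (j - i) z z, ∃ q ∈ wk adj (m - (j - i)) z z, ∃ r < m, (p ++ q).rotate r = L := by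
  have hl := wk_length h
  obtain ⟨h1, h2⟩ := wk_split' h (hij.trans hj) z hi
  have h3 : L.drop i ++ L.take i ∈ wk adj (m - i + i) z z := wk_append h2 h1
  rw [Nat.sub_add_cancel (by omega)] at h3
  have h4 : (L.drop i ++ L.take i)[j - i]? = some z := by
    rw [List.getElem?_append_left (by simp; omega), List.getElem?_drop,
      Nat.add_sub_cancel' hij.le]
    exact hj'
  obtain ⟨h5, h6⟩ := wk_split' h3 (by omega) z h4
  by_cases hi0 : i = 0
  · refine ⟨_, h5, _, h6, 0, by omega, ?_⟩
    subst hi0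
    simp
  · refine ⟨_, h5, _, h6, m - i, by omega, ?_⟩
    rw [List.take_append_drop]
    have : m - i = (L.drop i).length := by simp [hl]
    rw [this, List.rotate_append_length_eq, List.take_append_drop]

lemma wk_card (l : ℕ) (x y : W) : ((wk adj l x y).card : ℝ) =
    ((Matrix.of fun x y => if adj x y then (1:ℝ) else 0) ^ l) x y := by
  induction l generalizing x with
  | zero =>
    rw [pow_zero, Matrix.one_apply, wk]
    split_ifs <;> simp
  | succ l ih =>
    rw [pow_succ', Matrix.mul_apply, wk, Finset.card_biUnion]
    · push_cast
      rw [Finset.sum_filter]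
      refine Finset.sum_congr rfl fun z _ => ?_
      rw [Finset.card_image_of_injective _ (List.cons_injective), Matrix.of_apply, ih]
      split_ifs <;> simp
    · intro z _ z' _ hne
      rw [Function.onFun, Finset.disjoint_left]
      intro L hL hL'
      obtain ⟨M, hM, rfl⟩ := Finset.mem_image.mp hL
      obtain ⟨M', hM', he⟩ := Finset.mem_image.mp hL'
      obtain rfl := List.cons_injective he
      have a := wk_head hM
      have b := wk_head hM'
      rw [a] at b
      exact hne (Option.some.inj b)

/-- lists whose consecutive disjoint pairs lie in `Q` -/
def prs (Q : Finset (W × W)) : ℕ → Finset (List W)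
  | 0 => {[]}
  | k + 1 => (Q ×ˢ prs Q k).image (fun p => p.1.1 :: p.1.2 :: p.2)

lemma prs_card (Q : Finset (W × W)) (k : ℕ) : (prs Q k).card ≤ Q.card ^ k := by
  induction k with
  | zero => simp [prs]
  | succ k ih =>
    rw [prs, pow_succ, mul_comm]
    refine Finset.card_image_le.trans ?_
    rw [Finset.card_product]
    gcongr

lemma mem_prs (Q : Finset (W × W)) (k : ℕ) (L : List W) (hl : L.length = 2 * k)
    (h : ∀ i < k, ∃ u v, L[2 * i]? = some u ∧ L[2 * i + 1]? = some v ∧ (u, v) ∈ Q) :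
    L ∈ prs Q k := by
  induction k generalizing L with
  | zero => simp [prs]; exact List.length_eq_zero_iff.mp (by omega)
  | succ k ih =>
    match L, hl with
    | a :: b :: M, hl =>
      have h0 := h 0 (by omega)
      simp only [mul_zero, List.getElem?_cons_zero, zero_add, List.getElem?_cons_succ] at h0
      obtain ⟨u, v, hu, hv, huv⟩ := h0
      obtain rfl := Option.some.inj hu
      obtain rfl := Option.some.inj hv
      refine Finset.mem_image.mpr ⟨((a, b), M), Finset.mem_product.mpr ⟨huv, ?_⟩, rfl⟩
      apply ih
      · simp at hl ⊢; omega
      · intro i hi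
        have := h (i + 1) (by omega)
        rw [show 2 * (i + 1) = 2 * i + 1 + 1 by ring] at this
        simpa using this

lemma core [Nonempty W] (hsymm : ∀ x y, adj x y → adj y x) (hirr : ∀ x, ¬ adj x x) (k : ℕ)
    (hk : 2 ≤ k) (δ Δ N : ℝ) (hδ : 0 < δ)
    (hmin : ∀ x, δ ≤ (Finset.univ.filter (fun y => adj x y)).card)
    (hmax : ∀ x, ((Finset.univ.filter (fun y => adj x y)).card : ℝ) ≤ Δ)
    {β : Type*} (X : Finset β) (Bad : β → Finset (W × W)) (hBad : ∀ b ∈ X, ((Bad b).card : ℝ) ≤ Δ)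
    (hX : (X.card : ℝ) ≤ N) (hW : (Fintype.card W : ℝ) ≤ N)
    (hbig : (8 * (k:ℝ) ^ 2 * Δ) ^ k * N ≤ δ ^ (2 * k)) :
    ∃ c : Fin (2 * k) → W, Function.Injective c ∧ (∀ i, adj (c i) (c (nx i))) ∧
      ∀ b ∈ X, ∃ i, (c i, c (nx i)) ∉ Bad b := by
  by_contra hcon
  set A : Matrix W W ℝ := Matrix.of fun x y => if adj x y then (1:ℝ) else 0 with hAdef
  have hA : A.IsSymm := by
    ext x y
    simp only [A, Matrix.transpose_apply, Matrix.of_apply]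
    congr 1
    exact propext ⟨hsymm _ _, hsymm _ _⟩
  have hn : ∀ x y, 0 ≤ A x y := by
    intro x y; simp only [A, Matrix.of_apply]; split_ifs <;> norm_num
  have hrow : ∀ x, ∑ y, A x y = (Finset.univ.filter (fun y => adj x y)).card := by
    intro x; simp [A]
  have h0 : ∀ x, A x x = 0 := by intro x; simp [A, hirr]
  have hsq : ∀ x, (A ^ 2) x x = (Finset.univ.filter (fun y => adj x y)).card := by
    intro x
    have := diag_eq hA 1 x
    rw [mul_one] at this
    rw [this, ← hrow]
    refine Finset.sum_congr rfl fun y _ => ?_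
    simp only [pow_one, A, Matrix.of_apply]; split_ifs <;> norm_num
  have hsqpos : ∀ x, 0 < (A ^ 2) x x := fun x => by rw [hsq]; exact hδ.trans_le (hmin x)
  have hΔ : 0 < Δ := hδ.trans_le ((hmin (Classical.arbitrary W)).trans (hmax _))
  have hN : 0 < N := lt_of_lt_of_le (by exact_mod_cast Fintype.card_pos) hW
  -- the three sets
  let C : Finset (List W) := Finset.univ.biUnion fun x => wk adj (2 * k) x x
  let D : Finset (List W) := (Finset.range (2 * k)).biUnion fun r => (Finset.Ico 1 (2 * k)).biUnion fun j =>
    Finset.univ.biUnion fun x : W => (wk adj j x x ×ˢ wk adj (2 * k - j) x x).image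
      (fun p => (p.1 ++ p.2).rotate r)
  let T : Finset (List W) := X.biUnion fun b => prs (Bad b) k
  have hsub : C ⊆ D ∪ T := by
    intro L hL
    obtain ⟨x, _, hL⟩ := Finset.mem_biUnion.mp hL
    have hlen := wk_length hL
    by_cases hnd : L.Nodup
    · apply Finset.mem_union_right
      have hgood : ∀ i : Fin (2 * k), adj (L[i.val]'(by omega))
          (L[(nx i).val]'(by have := (nx i).isLt; omega)) := by
        intro i
        obtain ⟨u, v, hu, hv, huv⟩ := wk_adj hL i.val i.isLt
        have hi := i.isLt
        rw [List.getElem?_append_left (by omega), List.getElem?_eq_getElem (by omega)] at hu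
        obtain rfl := Option.some.inj hu
        by_cases hl : i.val + 1 = 2 * k
        · rw [List.getElem?_append_right (by omega)] at hv
          simp only [hlen, hl, Nat.sub_self, List.getElem?_cons_zero] at hv
          obtain rfl := Option.some.inj hv
          have hz : (nx i).val = 0 := by simp [nx, hl]
          have hh := wk_head hL
          rw [List.getElem?_append_left (by omega), List.getElem?_eq_getElem (by omega)] at hh
          simp only [hz]
          rw [Option.some.inj hh]; exact huv
        · rw [List.getElem?_append_left (by omega), List.getElem?_eq_getElem (by omega)] at hv
          obtain rfl := Option.some.inj hv
          have hz : (nx i).val = i.val + 1 := Nat.mod_eq_of_lt (by omega)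
          simp only [hz]; exact huv
      by_contra hT
      apply hcon
      refine ⟨fun i => L[i.val]'(by omega), ?_, hgood, ?_⟩
      · intro i j hij
        apply Fin.ext
        exact (List.Nodup.getElem_inj_iff hnd).mp hij
      · intro b hb
        by_contra hno
        push Not at hno
        apply hT
        refine Finset.mem_biUnion.mpr ⟨b, hb, mem_prs _ _ _ hlen ?_⟩
        intro i hi
        have := hno ⟨2 * i, by omega⟩
        have hz : (nx (⟨2 * i, by omega⟩ : Fin (2 * k))).val = 2 * i + 1 :=
          Nat.mod_eq_of_lt (by simp; omega)
        simp only [hz] at this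
        exact ⟨_, _, List.getElem?_eq_getElem (by omega), List.getElem?_eq_getElem (by omega), this⟩
    · apply Finset.mem_union_left
      rw [List.nodup_iff_getElem?_ne_getElem?] at hnd
      push Not at hnd
      obtain ⟨i, j, hij, hj, he⟩ := hnd
      rw [hlen] at hj
      obtain ⟨p, hp, q, hq, r, hr, hpq⟩ := wk_degenerate hL hij hj
        (List.getElem?_eq_getElem (by omega)) (he.symm.trans (List.getElem?_eq_getElem (by omega)))
      refine Finset.mem_biUnion.mpr ⟨r, Finset.mem_range.mpr hr, Finset.mem_biUnion.mpr ⟨j - i,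
        Finset.mem_Ico.mpr ⟨by omega, by omega⟩, Finset.mem_biUnion.mpr ⟨_, Finset.mem_univ _,
          Finset.mem_image.mpr ⟨(p, q), Finset.mem_product.mpr ⟨hp, hq⟩, hpq⟩⟩⟩⟩
  have hC : (C.card : ℝ) = hh A k := by
    rw [Finset.card_biUnion]
    · push_cast
      exact Finset.sum_congr rfl fun x _ => wk_card _ _ _
    · intro x _ x' _ hne
      rw [Function.onFun, Finset.disjoint_left]
      intro L hL hL'
      have a := wk_head hL
      have b := wk_head hL'
      have hl := wk_length hL
      rw [List.getElem?_append_left (by omega)] at a b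
      rw [a] at b
      exact hne (Option.some.inj b)
  have hD : (D.card : ℝ) ≤ 4 * (k:ℝ) ^ 2 * Δ * hh A (k - 1) := by
    have step : ∀ j ∈ Finset.Ico 1 (2 * k), ∀ r, ((Finset.univ.biUnion fun x : W =>
        (wk adj j x x ×ˢ wk adj (2 * k - j) x x).image (fun p => (p.1 ++ p.2).rotate r)).card : ℝ)
        ≤ Δ * hh A (k - 1) := by
      intro j hj r
      rw [Finset.mem_Ico] at hj
      calc _ ≤ ((∑ x : W, (wk adj j x x).card * (wk adj (2 * k - j) x x).card : ℕ) : ℝ) := by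
            norm_cast
            refine Finset.card_biUnion_le.trans (Finset.sum_le_sum fun x _ => ?_)
            refine Finset.card_image_le.trans ?_
            rw [Finset.card_product]
        _ = ∑ x : W, (A ^ j) x x * (A ^ (2 * k - j)) x x := by
            push_cast
            exact Finset.sum_congr rfl fun x _ => by rw [wk_card, wk_card]
        _ ≤ ∑ x : W, Δ * (A ^ (2 * (k - 1))) x x := by
            apply Finset.sum_le_sum
            intro x _
            refine (two_closed hA x (h0 x) (hsqpos x) k j hk hj.1 (by omega)).trans ?_
            apply mul_le_mul_of_nonneg_right _ (pow_nonneg' hn _ _ _)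
            rw [hsq]; exact hmax x
        _ = _ := by rw [← Finset.mul_sum]; rfl
    have hpos : 0 ≤ Δ * hh A (k - 1) := mul_nonneg hΔ.le
      (Finset.sum_nonneg fun x _ => pow_nonneg' hn _ _ _)
    calc (D.card : ℝ) ≤ ∑ r ∈ Finset.range (2 * k), ∑ j ∈ Finset.Ico 1 (2 * k), Δ * hh A (k - 1) := by
          refine le_trans (Nat.cast_le.mpr Finset.card_biUnion_le) ?_
          push_cast
          refine Finset.sum_le_sum fun r _ => ?_
          refine le_trans (Nat.cast_le.mpr Finset.card_biUnion_le) ?_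
          push_cast
          exact Finset.sum_le_sum fun j hj => step j hj r
      _ = (2 * k : ℕ) * ((2 * k - 1 : ℕ) * (Δ * hh A (k - 1))) := by
          simp [Finset.sum_const]
      _ ≤ (2 * k : ℕ) * ((2 * k : ℕ) * (Δ * hh A (k - 1))) := by
          gcongr; omega
      _ = _ := by push_cast; ring
  have hT : (T.card : ℝ) ≤ N * Δ ^ k := by
    calc (T.card : ℝ) ≤ ∑ b ∈ X, Δ ^ k := by
          refine le_trans (Nat.cast_le.mpr Finset.card_biUnion_le) ?_
          push_cast
          refine Finset.sum_le_sum fun b hb => ?_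
          refine le_trans (Nat.cast_le.mpr (prs_card _ _)) ?_
          push_cast
          have := hBad b hb
          gcongr
      _ = X.card * Δ ^ k := by simp
      _ ≤ _ := by gcongr
  have htot : hh A k ≤ 4 * (k:ℝ) ^ 2 * Δ * hh A (k - 1) + N * Δ ^ k := by
    rw [← hC]
    have h1 : C.card ≤ D.card + T.card := (Finset.card_le_card hsub).trans (Finset.card_union_le _ _)
    have h2 : (C.card : ℝ) ≤ D.card + T.card := by exact_mod_cast h1
    linarith
  have hlow : δ ^ (2 * k) ≤ hh A k := hh_lower hA hn δ hδ.le (fun x => by rw [hrow]; exact hmin x) k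
  have hhpos : ∀ l, 0 < hh A l := fun l => Finset.sum_pos
    (fun x _ => diag_pos hA x (hsqpos x) l) Finset.univ_nonempty
  have hzero : hh A 0 = Fintype.card W := by simp [hh]
  have hrat : 8 * (k:ℝ) ^ 2 * Δ * hh A (k - 1) ≤ hh A k := by
    obtain ⟨j, rfl⟩ : ∃ j, k = j + 1 := ⟨k - 1, by omega⟩
    have := ratio_last hhpos (hh_lc hA hn) (8 * ((j + 1 : ℕ):ℝ) ^ 2 * Δ) j (by
      refine le_trans ?_ (hbig.trans hlow)
      rw [hzero]
      gcongr)
    simpa using this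
  have hk1 : (2:ℝ) ≤ k := by exact_mod_cast hk
  have h8 : (3:ℝ) ≤ (8 * (k:ℝ) ^ 2) ^ k := by
    have h9 : (3:ℝ) ≤ 8 * (k:ℝ) ^ 2 := by nlinarith
    calc (3:ℝ) ≤ 8 * (k:ℝ) ^ 2 := h9
      _ ≤ _ := le_self_pow₀ (by linarith) (by omega)
  have hpp : 0 < N * Δ ^ k := by positivity
  have hfin : 3 * (N * Δ ^ k) ≤ hh A k := by
    refine le_trans ?_ (hbig.trans hlow)
    rw [mul_pow (8 * (k:ℝ) ^ 2) Δ k]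
    nlinarith
  nlinarith

end walks

section assembly

lemma nx_nx {m : ℕ} (hm : 3 ≤ m) (i : Fin m) : nx (nx i) ≠ i := by
  intro h
  have h := congrArg Fin.val h
  have hi := i.isLt
  simp only [nx] at h
  by_cases h1 : i.val + 1 = m
  · rw [h1, Nat.mod_self, Nat.mod_eq_of_lt (by omega)] at h; omega
  · rw [Nat.mod_eq_of_lt (show i.val + 1 < m by omega)] at h
    by_cases h2 : i.val + 1 + 1 = m
    · rw [h2, Nat.mod_self] at h; omega
    · rw [Nat.mod_eq_of_lt (by omega)] at h; omega

lemma min_deg {V : Type*} [DecidableEq V] (adj : V → V → Prop) [DecidableRel adj]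
    (hsymm : ∀ x y, adj x y → adj y x) (hirr : ∀ x, ¬ adj x x) (q m : ℕ) (hq : 0 < q) (n : ℕ) :
    ∀ S : Finset V, S.card = n → S.Nonempty →
      q * S.card ≤ m * ((S ×ˢ S).filter (fun p => adj p.1 p.2)).card →
      ∃ S' ⊆ S, S'.Nonempty ∧ ∀ a ∈ S', q ≤ 2 * m * (S'.filter (fun b => adj a b)).card := by
  induction n with
  | zero => intro S h hne; exact absurd (Finset.card_eq_zero.mp h) hne.ne_empty
  | succ n ih =>
    intro S hS hne hle
    by_cases hall : ∀ a ∈ S, q ≤ 2 * m * (S.filter (fun b => adj a b)).card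
    · exact ⟨S, subset_rfl, hne, hall⟩
    push Not at hall
    obtain ⟨a, ha, hlt⟩ := hall
    have hcard : (S.erase a).card = n := by rw [Finset.card_erase_of_mem ha]; omega
    have hf : ((S ×ˢ S).filter (fun p => adj p.1 p.2)).card ≤
        (((S.erase a) ×ˢ (S.erase a)).filter (fun p => adj p.1 p.2)).card +
          2 * (S.filter (fun b => adj a b)).card := by
      have hsub : (S ×ˢ S).filter (fun p => adj p.1 p.2) ⊆
          (((S.erase a) ×ˢ (S.erase a)).filter (fun p => adj p.1 p.2)) ∪
          ((S.filter (fun b => adj a b)).image (fun b => (a, b)) ∪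
           (S.filter (fun b => adj a b)).image (fun b => (b, a))) := by
        rintro ⟨u, v⟩ h
        simp only [Finset.mem_filter, Finset.mem_product] at h
        simp only [Finset.mem_union, Finset.mem_filter, Finset.mem_product, Finset.mem_erase,
          Finset.mem_image, Prod.mk.injEq]
        by_cases hu : u = a
        · subst hu; right; left; exact ⟨v, ⟨h.1.2, h.2⟩, rfl, rfl⟩
        · by_cases hv : v = a
          · subst hv; right; right; exact ⟨u, ⟨h.1.1, hsymm _ _ h.2⟩, rfl, rfl⟩
          · left; exact ⟨⟨⟨hu, h.1.1⟩, ⟨hv, h.1.2⟩⟩, h.2⟩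
      refine (Finset.card_le_card hsub).trans ((Finset.card_union_le _ _).trans ?_)
      have h1 := Finset.card_union_le ((S.filter (fun b => adj a b)).image (fun b => (a, b)))
        ((S.filter (fun b => adj a b)).image (fun b => (b, a)))
      have h2 := Finset.card_image_le (s := S.filter (fun b => adj a b)) (f := fun b => (a, b))
      have h3 := Finset.card_image_le (s := S.filter (fun b => adj a b)) (f := fun b => (b, a))
      omega
    have hkey : q * (S.erase a).card ≤
        m * (((S.erase a) ×ˢ (S.erase a)).filter (fun p => adj p.1 p.2)).card := by
      rw [hcard]
      rw [hS] at hle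
      have := Nat.mul_le_mul_left m hf
      nlinarith
    rcases (S.erase a).eq_empty_or_nonempty with he | hne'
    · exfalso
      have hSa : S = {a} := by
        rw [← Finset.insert_erase ha, he]; simp
      rw [hSa] at hle
      simp [Finset.filter_singleton, hirr] at hle
      omega
    · obtain ⟨S', h1, h2, h3⟩ := ih _ hcard hne' hkey
      exact ⟨S', h1.trans (Finset.erase_subset _ _), h2, h3⟩

lemma mono_cycle {V : Type*} {H H' : Finset (Finset V)} {m : ℕ} (h : H' ⊆ H)
    (hc : HasNonTrivialBergeCycle H' m) : HasNonTrivialBergeCycle H m := by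
  obtain ⟨e, he, h1, h2, h3⟩ := hc
  exact ⟨e, fun i => h (he i), h1, h2, h3⟩

lemma embed {V : Type*} [DecidableEq V] (H : Finset (Finset V)) (hu : ∀ e ∈ H, e.card = 3)
    (U : Finset V) (hU : ∀ e ∈ H, e ⊆ U) (hne : H.Nonempty) (Δ : ℝ)
    (hΔ : ∀ v ∈ U, ((H.filter (fun e => v ∈ e)).card : ℝ) ≤ Δ) (k : ℕ) (hk : 3 ≤ k)
    (hbig : (8 * (k:ℝ) ^ 2 * (9 * Δ)) ^ k * U.card ≤ ((H.card : ℝ) / (12 * k * U.card)) ^ (2 * k)) :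
    HasNonTrivialBergeCycle H (2 * k) := by
  rcases peel (6 * k) H.card H le_rfl with ⟨H', hs, h1, h2⟩ | ⟨P, φ, h1, h2, h3⟩
  · exact mono_cycle hs (heavy_cycle (fun e he => hu e (hs he)) h1 hk h2)
  have hHpos : 0 < H.card := Finset.card_pos.mpr hne
  have hPpos : 0 < P.card := by
    rcases Nat.eq_zero_or_pos P.card with h | h
    · rw [h] at h3; omega
    · exact h
  have hUne : U.Nonempty := by
    obtain ⟨e, he⟩ := hne
    have : e.Nonempty := Finset.card_pos.mp (by rw [hu e he]; norm_num)
    exact this.mono (hU e he)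
  have hUpos : 0 < U.card := Finset.card_pos.mpr hUne
  let adj : V → V → Prop := fun a b => ({a, b} : Finset V) ∈ P
  have hsymm : ∀ x y, adj x y → adj y x := by
    intro x y h; change ({y, x} : Finset V) ∈ P; rw [Finset.pair_comm]; exact h
  have hirr : ∀ x, ¬ adj x x := by
    intro x h; have := (h1 _ h).1; simp at this
  have hadj : ∀ {a b : V}, adj a b → a ∈ φ {a, b} ∧ b ∈ φ {a, b} ∧ φ {a, b} ∈ H := by
    intro a b h
    obtain ⟨_, hs, hH⟩ := h1 _ h
    exact ⟨hs (by simp), hs (by simp), hH⟩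
  have hf : P.card ≤ ((U ×ˢ U).filter (fun p => adj p.1 p.2)).card := by
    have hsub : P ⊆ ((U ×ˢ U).filter (fun p => adj p.1 p.2)).image (fun p => {p.1, p.2}) := by
      intro p hp
      obtain ⟨hc, hs, hH⟩ := h1 p hp
      obtain ⟨a, b, hab, rfl⟩ := Finset.card_eq_two.mp hc
      have := hs.trans (hU _ hH)
      refine Finset.mem_image.mpr ⟨(a, b), ?_, rfl⟩
      exact Finset.mem_filter.mpr ⟨Finset.mem_product.mpr ⟨this (by simp), this (by simp)⟩, hp⟩
    exact (Finset.card_le_card hsub).trans Finset.card_image_le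
  obtain ⟨S, hSU, hSne, hS⟩ := min_deg adj hsymm hirr P.card U.card hPpos U.card U rfl hUne (by
    rw [mul_comm]; gcongr)
  haveI : Nonempty S := hSne.to_subtype
  have hcardS : ∀ x : S, (Finset.univ.filter (fun y : S => adj x y)).card =
      (S.filter (fun b => adj x b)).card := by
    intro x
    rw [← Finset.card_map (Function.Embedding.subtype _)]
    congr 1
    ext b
    simp only [Finset.mem_map, Finset.mem_filter, Finset.mem_univ, true_and,
      Function.Embedding.coe_subtype, Subtype.exists, exists_and_left, exists_prop, exists_eq_right_right]
    tauto
  have hm0 : (0:ℝ) < U.card := by exact_mod_cast hUpos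
  have hk0 : (0:ℝ) < k := by exact_mod_cast (by omega : 0 < k)
  have hP0 : (0:ℝ) < P.card := by exact_mod_cast hPpos
  have hdeg0 : ∀ v ∈ U, (0:ℝ) ≤ Δ := fun v hv => le_trans (by positivity) (hΔ v hv)
  have hΔ0 : 0 ≤ Δ := hdeg0 _ hUne.choose_spec
  let Bad : V → Finset (S × S) := fun x =>
    Finset.univ.filter (fun p => adj p.1 p.2 ∧ x ∈ φ {(p.1 : V), (p.2 : V)})
  obtain ⟨c, hc, hca, hcb⟩ := core (adj := fun x y : S => adj x y) (fun x y h => hsymm _ _ h)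
    (fun x => hirr _) k (by omega) ((P.card : ℝ) / (2 * U.card)) (9 * Δ) U.card (by positivity)
    (by
      intro x
      rw [hcardS, div_le_iff₀ (by positivity)]
      have := hS x x.2
      have : (P.card : ℝ) ≤ 2 * U.card * (S.filter (fun b => adj x b)).card := by exact_mod_cast this
      linarith)
    (by
      intro x
      rw [hcardS]
      have hsub : S.filter (fun b => adj x b) ⊆ (H.filter (fun e => (x:V) ∈ e)).biUnion id := by
        intro b hb
        have hb := (Finset.mem_filter.mp hb).2
        obtain ⟨i1, i2, i3⟩ := hadj hb
        exact Finset.mem_biUnion.mpr ⟨_, Finset.mem_filter.mpr ⟨i3, i1⟩, i2⟩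
      have h5 : (S.filter (fun b => adj x b)).card ≤ (H.filter (fun e => (x:V) ∈ e)).card * 3 := by
        refine (Finset.card_le_card hsub).trans (Finset.card_biUnion_le_card_mul _ _ _ ?_)
        intro e he
        exact (hu e (Finset.mem_filter.mp he).1).le
      have h6 : ((S.filter (fun b => adj x b)).card : ℝ) ≤ (H.filter (fun e => (x:V) ∈ e)).card * 3 := by
        exact_mod_cast h5
      have := hΔ x (hSU x.2)
      linarith)
    U Bad
    (by
      intro x hx
      have hsub : (Bad x).map ((Function.Embedding.subtype _).prodMap (Function.Embedding.subtype _)) ⊆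
          (H.filter (fun e => x ∈ e)).biUnion (fun e => e ×ˢ e) := by
        intro p hp
        obtain ⟨⟨a, b⟩, hq, rfl⟩ := Finset.mem_map.mp hp
        obtain ⟨j1, j2⟩ := (Finset.mem_filter.mp hq).2
        obtain ⟨i1, i2, i3⟩ := hadj j1
        exact Finset.mem_biUnion.mpr ⟨_, Finset.mem_filter.mpr ⟨i3, j2⟩,
          Finset.mem_product.mpr ⟨i1, i2⟩⟩
      have h5 : (Bad x).card ≤ (H.filter (fun e => x ∈ e)).card * 9 := by
        rw [← Finset.card_map ((Function.Embedding.subtype _).prodMap (Function.Embedding.subtype _))]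
        refine (Finset.card_le_card hsub).trans (Finset.card_biUnion_le_card_mul _ _ _ ?_)
        intro e he
        rw [Finset.card_product, hu e (Finset.mem_filter.mp he).1]
      have h6 : ((Bad x).card : ℝ) ≤ (H.filter (fun e => x ∈ e)).card * 9 := by
        exact_mod_cast h5
      have := hΔ x hx
      linarith)
    le_rfl
    (by rw [Fintype.card_coe]; exact_mod_cast Finset.card_le_card hSU)
    (by
      refine hbig.trans ?_
      gcongr ?_ ^ (2 * k)
      rw [div_le_div_iff₀ (by positivity) (by positivity)]
      have : (H.card : ℝ) ≤ 6 * k * P.card := by exact_mod_cast h3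
      nlinarith)
  have hcv : ∀ {i j}, (c i : V) = c j → i = j := fun h => hc (Subtype.ext h)
  refine mk_cycle (fun i => (c i : V)) (fun i j h => hcv h)
    (fun i => φ {(c i : V), (c (nx i) : V)}) (fun i => (hadj (hca i)).2.2) ?_
    (fun i => (hadj (hca i)).1) (fun i => (hadj (hca i)).2.1) ?_
  · intro i j hij
    have h7 : ({(c i : V), (c (nx i) : V)} : Finset V) = {(c j : V), (c (nx j) : V)} :=
      h2 (hca i) (hca j) hij
    have m1 : (c i : V) ∈ ({(c j : V), (c (nx j) : V)} : Finset V) := by rw [← h7]; simp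
    have m2 : (c (nx i) : V) ∈ ({(c j : V), (c (nx j) : V)} : Finset V) := by rw [← h7]; simp
    simp only [Finset.mem_insert, Finset.mem_singleton] at m1 m2
    rcases m1 with m1 | m1
    · exact hcv m1
    · rcases m2 with m2 | m2
      · exfalso
        have a1 := hcv m1
        have a2 := hcv m2
        rw [a1] at a2
        exact nx_nx (by omega) j a2
      · exact nx_inj (hcv m2)
  · intro x
    by_cases hx : x ∈ U
    · obtain ⟨i, hi⟩ := hcb x hx
      refine ⟨i, fun h => hi ?_⟩
      exact Finset.mem_filter.mpr ⟨Finset.mem_univ _, hca i, h⟩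
    · exact ⟨⟨0, by omega⟩, fun h => hx (hU _ (hadj (hca _)).2.2 h)⟩

lemma main_comb {V : Type*} [DecidableEq V] (H : Finset (Finset V)) (hu : ∀ e ∈ H, e.card = 3)
    (k : ℕ) (hk : 3 ≤ k) (hno : ¬ HasNonTrivialBergeCycle H (2 * k)) (U : Finset V) (t Q : ℕ)
    (hQ : U.card ^ 3 < 2 ^ Q) (h4t : 4 * t ≤ U.card) (hU0 : 0 < U.card)
    (hbig : (82944 * (k:ℝ) ^ 4 * Q * (t:ℝ) ^ 2) ^ k ≤ ((U.card : ℝ) / 2) ^ (2 * k - 1)) :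
    ∃ I : Finset V, I.card = t ∧ ∀ e ∈ H, ¬ e ⊆ I := by
  rcases deletion H Q (U.card / 2) (U.card - U.card / 2) U (by omega) with
    ⟨U', _, h2, h3⟩ | ⟨U', _, h2, h3⟩
  · refine indep H hu U' t (by omega) ?_
    set H' := H.filter (fun e => e ⊆ U') with hH'
    rcases H'.eq_empty_or_nonempty with he | hne
    · rw [he]; simp
    set m : ℝ := (U'.card : ℝ) with hm
    have hm0 : 0 < m := by rw [hm]; exact_mod_cast (by omega : 0 < U'.card)
    have hmU : (U.card : ℝ) / 2 ≤ m := by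
      rw [hm, div_le_iff₀ (by norm_num)]
      exact_mod_cast (by omega : U.card ≤ U'.card * 2)
    set y : ℝ := (H'.card : ℝ) / m with hy
    have hy0 : 0 < y := div_pos (by exact_mod_cast Finset.card_pos.mpr hne) hm0
    have hHy : (H'.card : ℝ) = y * m := by rw [hy]; field_simp
    have hk0 : (0:ℝ) < k := by exact_mod_cast (by omega : 0 < k)
    have hnot : ¬ ((8 * (k:ℝ) ^ 2 * (9 * (Q * y))) ^ k * m ≤
        ((H'.card : ℝ) / (12 * k * m)) ^ (2 * k)) := by
      intro hb
      apply hno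
      refine mono_cycle (Finset.filter_subset _ _) (embed H' (fun e he => hu e (Finset.mem_filter.mp he).1)
        U' (fun e he => (Finset.mem_filter.mp he).2) hne (Q * y) ?_ k hk hb)
      intro v hv
      have h5 := h3 v hv
      rw [hH', Finset.filter_filter]
      have h6 : ((H.filter (fun e => e ⊆ U' ∧ v ∈ e)).card : ℝ) * m < Q * H'.card := by
        rw [hm]; exact_mod_cast h5
      rw [hHy] at h6
      have : ((H.filter (fun e => e ⊆ U' ∧ v ∈ e)).card : ℝ) * m < (Q * y) * m := by linarith
      exact (lt_of_mul_lt_mul_right this hm0.le).le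
    push Not at hnot
    have e1 : (H'.card : ℝ) / (12 * k * m) = y / (12 * k) := by
      rw [hHy]; field_simp
    rw [e1] at hnot
    clear_value y m
    -- y ^ k < (10368 k^4 Q)^k * m
    have h7 : y ^ k < (10368 * (k:ℝ) ^ 4 * Q) ^ k * m := by
      have e2 : (y / (12 * k)) ^ (2 * k) * ((144 * (k:ℝ) ^ 2) ^ k) = y ^ k * y ^ k := by
        rw [pow_mul, ← mul_pow, ← mul_pow]
        congr 1
        field_simp
        norm_num
      have e3 : (8 * (k:ℝ) ^ 2 * (9 * (Q * y))) ^ k * m * ((144 * (k:ℝ) ^ 2) ^ k)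
          = ((10368 * (k:ℝ) ^ 4 * Q) ^ k * m) * y ^ k := by
        have e4 : (8 * (k:ℝ) ^ 2 * (9 * (Q * y))) * (144 * (k:ℝ) ^ 2)
            = (10368 * (k:ℝ) ^ 4 * Q) * y := by ring
        rw [mul_right_comm ((8 * (k:ℝ) ^ 2 * (9 * (Q * y))) ^ k) m, ← mul_pow, e4, mul_pow _ y]
        ring
      have h8 : y ^ k * y ^ k < ((10368 * (k:ℝ) ^ 4 * Q) ^ k * m) * y ^ k := by
        rw [← e2, ← e3]
        exact mul_lt_mul_of_pos_right hnot (by positivity)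
      exact lt_of_mul_lt_mul_right h8 (by positivity)
    have h9 : (8 * y * (t:ℝ) ^ 2) ^ k ≤ (m ^ 2) ^ k := by
      calc (8 * y * (t:ℝ) ^ 2) ^ k = (8 * (t:ℝ) ^ 2) ^ k * y ^ k := by
            rw [← mul_pow]; congr 1; ring
        _ ≤ (8 * (t:ℝ) ^ 2) ^ k * ((10368 * (k:ℝ) ^ 4 * Q) ^ k * m) :=
            mul_le_mul_of_nonneg_left h7.le (by positivity)
        _ = (82944 * (k:ℝ) ^ 4 * Q * (t:ℝ) ^ 2) ^ k * m := by
            rw [← mul_assoc, ← mul_pow, show 8 * (t:ℝ) ^ 2 * (10368 * (k:ℝ) ^ 4 * Q) = 82944 * (k:ℝ) ^ 4 * Q * (t:ℝ) ^ 2 by ring]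
        _ ≤ ((U.card : ℝ) / 2) ^ (2 * k - 1) * m := by gcongr
        _ ≤ m ^ (2 * k - 1) * m :=
            mul_le_mul_of_nonneg_right
              (pow_le_pow_left₀ (div_nonneg (Nat.cast_nonneg _) (by norm_num)) hmU _) hm0.le
        _ = (m ^ 2) ^ k := by
            rw [← pow_succ, ← pow_mul]; congr 1; omega
    have h10 : 8 * y * (t:ℝ) ^ 2 ≤ m ^ 2 :=
      le_of_pow_le_pow_left₀ (by omega) (by positivity) h9
    rw [hHy]
    calc 8 * (y * m) * (t:ℝ) ^ 2 = (8 * y * (t:ℝ) ^ 2) * m := by ring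
      _ ≤ m ^ 2 * m := by gcongr
      _ = m ^ 3 := by ring
  · refine indep H hu U' t (by omega) ?_
    have hN0 : (0:ℝ) < U.card := by exact_mod_cast hU0
    have hs : ((U.card / 2 : ℕ) : ℝ) ≤ (U.card : ℝ) / 2 := Nat.cast_div_le
    have hE : ((H.filter (fun e => e ⊆ U)).card : ℝ) ≤ (U.card : ℝ) ^ 3 := by
      have hsub : H.filter (fun e => e ⊆ U) ⊆ Finset.powersetCard 3 U := by
        intro e he
        obtain ⟨a, b⟩ := Finset.mem_filter.mp he
        exact Finset.mem_powersetCard.mpr ⟨b, hu e a⟩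
      have := Finset.card_le_card hsub
      rw [Finset.card_powersetCard] at this
      exact_mod_cast this.trans (Nat.choose_le_pow _ _)
    have hx : (H.filter (fun e => e ⊆ U')).card = 0 := by
      by_contra hpos
      have hpos : (1:ℝ) ≤ (H.filter (fun e => e ⊆ U')).card := by
        exact_mod_cast Nat.one_le_iff_ne_zero.mpr hpos
      have h5 : (U.card : ℝ) ^ Q ≤ (U.card : ℝ) ^ 3 * ((U.card : ℝ) / 2) ^ Q := by
        calc (U.card : ℝ) ^ Q ≤ (H.filter (fun e => e ⊆ U')).card * (U.card : ℝ) ^ Q :=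
              le_mul_of_one_le_left (by positivity) hpos
          _ ≤ _ := h3
          _ ≤ _ := by gcongr
      have h6 : (U.card : ℝ) ^ 3 < 2 ^ Q := by exact_mod_cast hQ
      have h7 : (U.card : ℝ) ^ 3 * ((U.card : ℝ) / 2) ^ Q < (U.card : ℝ) ^ Q := by
        rw [div_pow, mul_div_assoc', div_lt_iff₀ (by positivity), mul_comm]
        gcongr
      linarith
    rw [hx]; simp

end assembly

end BergeAux

open BergeAux in
theorem stmt_13 (k : ℕ) (hk : 3 ≤ k) :
    ∃ t₀ : ℕ, ∀ t : ℕ, t₀ ≤ t →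
      ∀ (V : Type) (_ : Fintype V) (_ : DecidableEq V),
        (t : ℝ) ^ ((2 * (k : ℝ)) / (2 * (k : ℝ) - 1) + 4 / Real.sqrt (Real.log t)) ≤
          (Fintype.card V : ℝ) →
        ∀ H : Finset (Finset V), (∀ e ∈ H, e.card = 3) →
          HasNonTrivialBergeCycle H (2 * k) ∨
          ∃ I : Finset V, I.card = t ∧ ∀ e ∈ H, ¬ e ⊆ I := by
  refine ⟨⌈Real.exp ((1000000 * (k:ℝ) ^ 4) ^ 2)⌉₊, ?_⟩
  intro t ht V _ _ hV H hu
  by_cases hno : HasNonTrivialBergeCycle H (2 * k)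
  · exact Or.inl hno
  right
  have hk3 : (3:ℝ) ≤ k := by exact_mod_cast hk
  have ht' : Real.exp ((1000000 * (k:ℝ) ^ 4) ^ 2) ≤ t := Nat.ceil_le.mp ht
  have htpos : (0:ℝ) < t := (Real.exp_pos _).trans_le ht'
  set L := Real.log t with hL
  have hLge : (1000000 * (k:ℝ) ^ 4) ^ 2 ≤ L := (Real.le_log_iff_exp_le htpos).mpr ht'
  set y := Real.sqrt L with hy
  have hyge : 1000000 * (k:ℝ) ^ 4 ≤ y := Real.le_sqrt_of_sq_le hLge
  have hk4 : (1:ℝ) ≤ (k:ℝ) ^ 4 := one_le_pow₀ (by linarith)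
  have hy1 : 1000000 ≤ y := by linarith
  have hy2 : y ^ 2 = L := Real.sq_sqrt (by linarith [sq_nonneg (1000000 * (k:ℝ) ^ 4)])
  set α := (2 * (k : ℝ)) / (2 * (k : ℝ) - 1) with hα
  have hα1 : 1 ≤ α := by rw [hα, le_div_iff₀ (by linarith)]; linarith
  have hα2 : α ≤ 6 / 5 := by rw [hα, div_le_iff₀ (by linarith)]; linarith
  have htexp : (t:ℝ) = Real.exp L := (Real.exp_log htpos).symm
  set x := (t : ℝ) ^ (α + 4 / y) with hx
  have hxexp : x = Real.exp (α * L + 4 * y) := by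
    rw [hx, Real.rpow_def_of_pos htpos, ← hL]
    congr 1
    rw [← hy2]; field_simp
  have hxpos : 0 < x := by rw [hxexp]; exact Real.exp_pos _
  have hcard : ⌈x⌉₊ ≤ (Finset.univ : Finset V).card := by
    rw [Finset.card_univ]; exact Nat.ceil_le.mpr hV
  obtain ⟨U, _, hU⟩ := Finset.exists_subset_card_eq hcard
  have hxN : x ≤ U.card := by rw [hU]; exact Nat.le_ceil x
  have hNx : (U.card : ℝ) < x + 1 := by rw [hU]; exact Nat.ceil_lt_add_one hxpos.le
  have hL0 : 0 < L := by rw [← hy2]; positivity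
  have hE3 : 10 * y ^ 3 ≤ Real.exp (4 * y) := by
    have := Real.pow_div_factorial_le_exp (4 * y) (by linarith) 3
    have h6 : ((Nat.factorial 3 : ℕ) : ℝ) = 6 := by norm_num [Nat.factorial]
    rw [h6] at this
    have hy3 : 0 ≤ y ^ 3 := by positivity
    nlinarith
  have hE4 : (4:ℝ) ≤ Real.exp (4 * y) := by linarith [Real.add_one_le_exp (4 * y)]
  have h4t : (4:ℝ) * t ≤ x := by
    rw [hxexp, Real.exp_add, htexp]
    have h5 : Real.exp L ≤ Real.exp (α * L) := Real.exp_le_exp.mpr (by nlinarith)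
    calc 4 * Real.exp L = Real.exp L * 4 := by ring
      _ ≤ _ := by gcongr
  have hU4 : 4 * t ≤ U.card := by exact_mod_cast h4t.trans hxN
  have hU0 : 0 < U.card := by exact_mod_cast hxpos.trans_le hxN
  have hx1 : 1 ≤ x := by rw [hxexp]; exact Real.one_le_exp (by positivity)
  have hlogN : Real.log U.card ≤ 2 * L := by
    have h5 : Real.log U.card ≤ Real.log (2 * x) :=
      Real.log_le_log (by exact_mod_cast hU0) (by linarith)
    rw [Real.log_mul (by norm_num) hxpos.ne', hxexp, Real.log_exp] at h5
    have h6 : Real.log 2 ≤ 1 := by linarith [Real.log_two_lt_d9]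
    have h7 : α * L ≤ 6 / 5 * L := by gcongr
    nlinarith
  set Q := 3 * (Nat.log 2 U.card + 1) with hQdef
  have hQ : U.card ^ 3 < 2 ^ Q := by
    rw [hQdef, mul_comm, pow_mul]
    exact Nat.pow_lt_pow_left (Nat.lt_pow_succ_log_self (by norm_num) _) (by norm_num)
  have hQL : (Q : ℝ) ≤ 10 * L := by
    have h5 : 2 ^ (Nat.log 2 U.card) ≤ U.card := Nat.pow_log_le_self 2 hU0.ne'
    have h6 : ((2:ℝ) ^ (Nat.log 2 U.card)) ≤ U.card := by exact_mod_cast h5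
    have h7 := Real.log_le_log (by positivity) h6
    rw [Real.log_pow] at h7
    have h8 := Real.log_two_gt_d9
    have h9 : (Nat.log 2 U.card : ℝ) * 0.69 ≤ 2 * L := by
      refine le_trans ?_ (h7.trans hlogN)
      gcongr
      linarith
    have h10 : 10 ≤ L := by nlinarith
    rw [hQdef]; push_cast
    linarith
  refine main_comb H hu k hk hno U t Q hQ hU4 hU0 ?_
  have hbase : 4 * (82944 * (k:ℝ) ^ 4 * Q) ≤ Real.exp (4 * y) := by
    refine le_trans ?_ hE3
    calc 4 * (82944 * (k:ℝ) ^ 4 * Q) ≤ 4 * (82944 * (k:ℝ) ^ 4 * (10 * y ^ 2)) := by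
          rw [hy2]; gcongr
      _ = 10 * (y ^ 2 * (331776 * (k:ℝ) ^ 4)) := by ring
      _ ≤ 10 * (y ^ 2 * y) := by
          gcongr; linarith
      _ = 10 * y ^ 3 := by ring
  have hxp : x ^ (2 * k - 1) = ((t:ℝ) ^ 2) ^ k * Real.exp (4 * y) ^ (2 * k - 1) := by
    rw [hxexp, Real.exp_add, mul_pow, htexp, ← Real.exp_nat_mul, ← Real.exp_nat_mul, ← Real.exp_nat_mul]
    congr 2
    rw [Nat.cast_sub (by omega)]
    push_cast
    rw [hα]
    have : (2 * (k:ℝ) - 1) ≠ 0 := by linarith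
    field_simp
    rw [← Real.exp_nat_mul]
    congr 1
    ring
  have hE1 : (1:ℝ) ≤ Real.exp (4 * y) := by linarith
  calc (82944 * (k:ℝ) ^ 4 * Q * (t:ℝ) ^ 2) ^ k
      = ((t:ℝ) ^ 2) ^ k * (4 * (82944 * (k:ℝ) ^ 4 * Q)) ^ k / 4 ^ k := by
        rw [← mul_pow, ← div_pow]; congr 1; ring
    _ ≤ ((t:ℝ) ^ 2) ^ k * Real.exp (4 * y) ^ k / 4 ^ k := by gcongr
    _ ≤ ((t:ℝ) ^ 2) ^ k * Real.exp (4 * y) ^ (2 * k - 1) / 4 ^ k := by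
        gcongr
        omega
    _ = x ^ (2 * k - 1) / 4 ^ k := by rw [hxp]
    _ ≤ x ^ (2 * k - 1) / 2 ^ (2 * k - 1) := by
        gcongr
        rw [show (4:ℝ) = 2 ^ 2 by norm_num, ← pow_mul]
        exact pow_le_pow_right₀ (by norm_num) (by omega)
    _ = (x / 2) ^ (2 * k - 1) := by rw [div_pow]
    _ ≤ ((U.card : ℝ) / 2) ^ (2 * k - 1) := by gcongr
end

section
/- Suppose for some k ≥ 2 and constant c > 0 there exist, for all large n, n-vertex graphs of girth greater than 2k with at least c·n^(1+1/k) edges. Then for every r ≥ 3 there is a constant c_{k,r} > 0 such that for all large t, R(t, B^r_k) ≥ c_{k,r}·(t/log t)^{k/(k-1)}, where B^r_k is the family of r-uniform non-trivial Berge k-cycles. -/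
set_option maxHeartbeats 1000000 in
lemma prob_core {V ι : Type*} [Fintype V] [DecidableEq V] [Fintype ι] [DecidableEq ι]
    (x0 : V) (s t d : ℕ) (ht : 1 ≤ t) (S : ι → Finset V) (K : ι → Finset V → Finset V)
    (hKS : ∀ b I, K b I ⊆ S b) (hS0 : ∀ b, 0 < (S b).card) (hSs : ∀ b, (S b).card ≤ s + 1)
    (hsum : ∀ I : Finset V, I.card = t → t * d ≤ 2 * ∑ b, (K b I).card)
    (h2 : 2 * ((s : ℝ) + 1) * Real.log (Fintype.card V) < d) :
    ∃ cen : ι → V, ∀ I : Finset V, I.card = t → ∃ b, cen b ∈ K b I := by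
  obtain ⟨P, hP⟩ : ∃ P, P = Finset.powersetCard t (Finset.univ : Finset V) := ⟨_, rfl⟩
  obtain ⟨bad, hbd⟩ : ∃ bad : Finset V → Finset (ι → V),
    ∀ I, bad I = Fintype.piFinset (fun b => S b \ K b I) := ⟨_, fun _ => rfl⟩
  have hbad : ∀ I ∈ P, ((bad I).card : ℝ) ≤
      (∏ b, ((S b).card : ℝ)) * Real.exp (-(t * d / (2 * ((s : ℝ) + 1)))) := by
    intro I hI
    have hIt := (Finset.mem_powersetCard.mp (hP ▸ hI)).2
    have hsu : (t : ℝ) * d ≤ 2 * ∑ b, ((K b I).card : ℝ) := by exact_mod_cast hsum I hIt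
    rw [hbd, Fintype.card_piFinset]
    push_cast
    calc ∏ b, ((S b \ K b I).card : ℝ)
        ≤ ∏ b, (((S b).card : ℝ) * Real.exp (-((K b I).card / ((s : ℝ) + 1)))) := by
          apply Finset.prod_le_prod
          · intros; positivity
          · intro b _
            have hc : ((S b \ K b I).card : ℝ) = (S b).card - (K b I).card := by
              rw [eq_sub_iff_add_eq]
              exact_mod_cast Finset.card_sdiff_add_card_eq_card (hKS b I)
            have hS0' : (0 : ℝ) < (S b).card := by exact_mod_cast hS0 b
            have hSs' : ((S b).card : ℝ) ≤ s + 1 := by exact_mod_cast hSs b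
            have := Real.add_one_le_exp (-((K b I).card / ((s : ℝ) + 1)))
            have h4 : ((S b).card : ℝ) * ((K b I).card / ((s : ℝ) + 1)) ≤ (K b I).card := by
              rw [mul_div_assoc', div_le_iff₀ (by positivity), mul_comm]
              gcongr
            rw [hc]
            nlinarith [mul_le_mul_of_nonneg_left this hS0'.le]
      _ = (∏ b, ((S b).card : ℝ)) * Real.exp (-((∑ b, ((K b I).card : ℝ)) / ((s : ℝ) + 1))) := by
          rw [Finset.prod_mul_distrib, ← Real.exp_sum, Finset.sum_neg_distrib, Finset.sum_div]
      _ ≤ _ := by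
          apply mul_le_mul_of_nonneg_left _ (by positivity)
          apply Real.exp_le_exp.mpr
          apply neg_le_neg
          rw [div_le_div_iff₀ (by positivity) (by positivity)]
          have : (0 : ℝ) ≤ (s : ℝ) + 1 := by positivity
          nlinarith [mul_le_mul_of_nonneg_right hsu this]
  have hN : (0 : ℝ) < Fintype.card V := by
    exact_mod_cast Fintype.card_pos_iff.mpr ⟨x0⟩
  have hcard : (P.biUnion bad).card < (Fintype.piFinset S).card := by
    have hprod : (0 : ℝ) < ∏ b, ((S b).card : ℝ) :=
      Finset.prod_pos (fun b _ => by exact_mod_cast hS0 b)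
    have : ((P.biUnion bad).card : ℝ) < (Fintype.piFinset S).card := by
      calc ((P.biUnion bad).card : ℝ) ≤ ∑ I ∈ P, ((bad I).card : ℝ) := by
            exact_mod_cast Finset.card_biUnion_le
        _ ≤ ∑ I ∈ P, (∏ b, ((S b).card : ℝ)) * Real.exp (-(t * d / (2 * ((s : ℝ) + 1)))) :=
            Finset.sum_le_sum hbad
        _ = (P.card : ℝ) * ((∏ b, ((S b).card : ℝ)) * Real.exp (-(t * d / (2 * ((s : ℝ) + 1))))) := by
            rw [Finset.sum_const, nsmul_eq_mul]
        _ ≤ (Fintype.card V : ℝ) ^ t *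
            ((∏ b, ((S b).card : ℝ)) * Real.exp (-(t * d / (2 * ((s : ℝ) + 1))))) := by
            apply mul_le_mul_of_nonneg_right _ (by positivity)
            have : P.card ≤ Fintype.card V ^ t := by
              rw [hP, Finset.card_powersetCard, Finset.card_univ]
              exact Nat.choose_le_pow _ _
            exact_mod_cast this
        _ = (∏ b, ((S b).card : ℝ)) *
            Real.exp (t * Real.log (Fintype.card V) - t * d / (2 * ((s : ℝ) + 1))) := by
            rw [sub_eq_add_neg, Real.exp_add, mul_comm (t : ℝ) (Real.log _), Real.exp_mul,
              Real.exp_log hN, Real.rpow_natCast]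
            ring
        _ < (∏ b, ((S b).card : ℝ)) * 1 := by
            apply mul_lt_mul_of_pos_left _ hprod
            rw [Real.exp_lt_one_iff, sub_neg, lt_div_iff₀ (by positivity)]
            have : (0 : ℝ) < t := by exact_mod_cast ht
            nlinarith [mul_lt_mul_of_pos_left h2 this]
        _ = (Fintype.piFinset S).card := by
            rw [Fintype.card_piFinset]; push_cast; ring
    exact_mod_cast this
  obtain ⟨cen, hc, hnc⟩ := Finset.exists_mem_notMem_of_card_lt_card hcard
  refine ⟨cen, fun I hI => ?_⟩
  by_contra hcon
  push Not at hcon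
  apply hnc
  rw [Finset.mem_biUnion]
  refine ⟨I, by rw [hP]; exact Finset.mem_powersetCard.mpr ⟨Finset.subset_univ _, hI⟩, ?_⟩
  rw [hbd]
  rw [Fintype.mem_piFinset] at hc ⊢
  intro b
  rw [Finset.mem_sdiff]
  exact ⟨hc b, hcon b⟩

lemma prob_aux {V ι : Type*} [Fintype V] [DecidableEq V] [Fintype ι] [DecidableEq ι] [Nonempty V]
    (blk : ι → Finset V) (s t d r : ℕ) (ht : 1 ≤ t) (hs : ∀ b, (blk b).card ≤ s)
    (hd : ∀ x, d ≤ (Finset.univ.filter (fun b => x ∈ blk b)).card)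
    (h1 : 2 * (r * Fintype.card ι) ≤ t * d)
    (h2 : 2 * ((s : ℝ) + 1) * Real.log (Fintype.card V) < d) :
    ∃ cen : ι → V, ∀ I : Finset V, I.card = t →
      ∃ b, cen b ∈ I ∧ cen b ∈ blk b ∧ r ≤ (I ∩ blk b).card := by
  obtain ⟨x0⟩ := ‹Nonempty V›
  let K : ι → Finset V → Finset V := fun b I => if r ≤ (I ∩ blk b).card then I ∩ blk b else ∅
  let S : ι → Finset V := fun b => insert x0 (blk b)
  have hKS : ∀ b I, K b I ⊆ S b := by
    intro b I
    dsimp only [K, S]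
    split_ifs
    · exact Finset.inter_subset_right.trans (Finset.subset_insert _ _)
    · simp
  have hS0 : ∀ b, 0 < (S b).card := fun b => Finset.card_pos.mpr ⟨x0, by simp [S]⟩
  have hSs : ∀ b, (S b).card ≤ s + 1 := fun b => (Finset.card_insert_le _ _).trans (by
    have := hs b; omega)
  have hsum : ∀ I : Finset V, I.card = t → t * d ≤ 2 * ∑ b, (K b I).card := by
    intro I hI
    have e1 : t * d ≤ ∑ b, (I ∩ blk b).card := by
      have : ∑ b, (I ∩ blk b).card = ∑ x ∈ I, (Finset.univ.filter (fun b => x ∈ blk b)).card := by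
        simp_rw [Finset.card_filter, ← Finset.filter_mem_eq_inter, Finset.card_filter]
        rw [Finset.sum_comm]
      rw [this, ← hI, ← smul_eq_mul]
      exact Finset.card_nsmul_le_sum _ _ _ (fun x _ => hd x)
    have e2 : ∑ b, (I ∩ blk b).card ≤ ∑ b, ((K b I).card + r) := by
      apply Finset.sum_le_sum
      intro b _
      dsimp only [K]
      split_ifs with h
      · omega
      · simp; omega
    rw [Finset.sum_add_distrib] at e2
    simp at e2
    rw [mul_comm (Fintype.card ι)] at e2
    omega
  obtain ⟨cen, hcen⟩ := prob_core x0 s t d ht S K hKS hS0 hSs hsum h2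
  refine ⟨cen, fun I hI => ?_⟩
  obtain ⟨b, hK⟩ := hcen I hI
  refine ⟨b, ?_⟩
  dsimp only [K] at hK
  split_ifs at hK with h
  · rw [Finset.mem_inter] at hK
    exact ⟨hK.1, hK.2, h⟩
  · simp at hK

lemma berge_aux {V ι : Type*} [Fintype V] [DecidableEq V] (k t r : ℕ) (hk : 2 ≤ k)
    (blk : ι → Finset V) (hr : 1 ≤ r)
    (hcyc : ∀ (A : ℕ → V) (B : ℕ → ι), (∀ i j, i < j → j < k → A i ≠ A j) →
      (∀ i, i < k → A i ∈ blk (B i)) → (∀ i, i < k → A i ∈ blk (B (i + 1))) → B k = B 0 →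
      ∀ i, i ≤ k → B i = B 0)
    (cen : ι → V) (hcen : ∀ I : Finset V, I.card = t →
      ∃ b, cen b ∈ I ∧ cen b ∈ blk b ∧ r ≤ (I ∩ blk b).card) :
    ∃ H : Finset (Finset V), (∀ e ∈ H, e.card = r) ∧
          ¬ HasNonTrivialBergeCycle H k ∧
          ¬ ∃ I : Finset V, I.card = t ∧ ∀ e ∈ H, ¬ e ⊆ I := by
  classical
  refine ⟨Finset.univ.filter (fun e => e.card = r ∧ ∃ b, cen b ∈ e ∧ e ⊆ blk b), ?_, ?_, ?_⟩
  · intro e he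
    exact (Finset.mem_filter.mp he).2.1
  · rintro ⟨e, he, -, ⟨w, hw, hwe⟩, hint⟩
    have he' : ∀ i, ∃ b, cen b ∈ e i ∧ e i ⊆ blk b := fun i => (Finset.mem_filter.mp (he i)).2.2
    choose b hb1 hb2 using he'
    have hk0 : 0 < k := by omega
    let M : ℕ → Fin k := fun i => ⟨i % k, Nat.mod_lt _ hk0⟩
    have := hcyc (fun i => w (M i)) (fun i => b (M i)) ?_ ?_ ?_ ?_
    · have hall : ∀ i : Fin k, b i = b (M 0) := by
        intro i
        have h := this i.val i.isLt.le
        have hi : M i.val = i := by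
          apply Fin.ext; exact Nat.mod_eq_of_lt i.isLt
        simpa only [hi] using h
      have : cen (b (M 0)) ∈ (⋂ i, (e i : Set V)) := by
        rw [Set.mem_iInter]
        intro i
        rw [← hall i]
        exact hb1 i
      rw [hint] at this
      exact this
    · intro i j hij hj h
      have := congrArg Fin.val (hw h)
      simp only [M] at this
      rw [Nat.mod_eq_of_lt hj, Nat.mod_eq_of_lt (hij.trans hj)] at this
      omega
    · intro i hi
      exact hb2 _ (hwe _).1
    · intro i hi
      apply hb2
      have := (hwe (M i)).2
      have h : (⟨((M i).val + 1) % k, Nat.mod_lt _ (M i).pos⟩ : Fin k) = M (i + 1) := by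
        apply Fin.ext
        simp [M]
      rwa [h] at this
    · simp [M]
  · rintro ⟨I, hI, hind⟩
    obtain ⟨b, h1, h2, h3⟩ := hcen I hI
    obtain ⟨e, he1, he2, he3⟩ := Finset.exists_subsuperset_card_eq
      (s := {cen b}) (t := I ∩ blk b) (n := r) (by simp [h1, h2]) (by simpa using hr) h3
    refine hind e ?_ (he2.trans Finset.inter_subset_left)
    rw [Finset.mem_filter]
    exact ⟨Finset.mem_univ _, he3, b, Finset.singleton_subset_iff.mp he1,
      he2.trans Finset.inter_subset_right⟩

lemma chunk_aux {α β : Type*} [DecidableEq α] [DecidableEq β] [Fintype β] (p : α → β) (D : ℕ)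
    (hD : 0 < D) (F : Finset α) : ∃ L : Finset (Finset α),
      (∀ A ∈ L, A ⊆ F ∧ A.card = D ∧ ∀ x ∈ A, ∀ y ∈ A, p x = p y) ∧
      (∀ A ∈ L, ∀ B ∈ L, A ≠ B → Disjoint A B) ∧
      F.card ≤ D * L.card + D * Fintype.card β := by
  induction F using Finset.strongInduction with
  | H F ih =>
    by_cases h : F.card ≤ D * Fintype.card β
    · exact ⟨∅, by simp, by simp, by simpa using h⟩
    · push Not at h
      obtain ⟨y, -, hy⟩ := Finset.exists_lt_card_fiber_of_mul_lt_card_of_maps_to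
        (s := F) (t := Finset.univ) (f := p) (n := D) (fun _ _ => Finset.mem_univ _)
        (by rw [Finset.card_univ, mul_comm]; exact h)
      obtain ⟨A, hA, hAc⟩ := Finset.exists_subset_card_eq hy.le
      have hAF : A ⊆ F := hA.trans (Finset.filter_subset _ _)
      have hAne : A.Nonempty := Finset.card_pos.mp (by omega)
      have hss : F \ A ⊂ F := Finset.sdiff_ssubset hAF hAne
      obtain ⟨L, h1, h2, h3⟩ := ih _ hss
      have hd : ∀ B ∈ L, Disjoint A B := fun B hB =>
        Finset.disjoint_of_subset_right (h1 B hB).1 Finset.disjoint_sdiff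
      have hAL : A ∉ L := fun hh => by
        have := hd A hh
        rw [disjoint_self] at this
        exact hAne.ne_empty this
      refine ⟨insert A L, ?_, ?_, ?_⟩
      · intro B hB
        rcases Finset.mem_insert.mp hB with rfl | hB
        · refine ⟨hAF, hAc, fun x hx z hz => ?_⟩
          rw [(Finset.mem_filter.mp (hA hx)).2, (Finset.mem_filter.mp (hA hz)).2]
        · exact ⟨(h1 B hB).1.trans Finset.sdiff_subset, (h1 B hB).2⟩
      · intro B hB C hC hBC
        rcases Finset.mem_insert.mp hB with hB | hB <;>
          rcases Finset.mem_insert.mp hC with hC | hC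
        · exact absurd (hB.trans hC.symm) hBC
        · rw [hB]; exact hd _ hC
        · rw [hC]; exact (hd _ hB).symm
        · exact h2 _ hB _ hC hBC
      · rw [Finset.card_insert_of_notMem hAL, mul_add]
        have := Finset.card_sdiff_add_card_eq_card hAF
        omega

lemma ext_path {V : Type*} {G : SimpleGraph V} {K : ℕ}
    (hg : ∀ v (c : G.Walk v v), c.IsCycle → K < c.length) {u v w : V} (q : G.Walk v w)
    (hq : q.IsPath) (h : G.Adj u v) (hlen : q.length + 1 ≤ K) (hne : ¬ q.Nil → q.snd ≠ u) :
    (SimpleGraph.Walk.cons h q).IsPath := by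
  classical
  rw [SimpleGraph.Walk.cons_isPath_iff]
  refine ⟨hq, fun hu => ?_⟩
  have hp := hq.takeUntil hu
  have hl := q.length_takeUntil_le_length hu
  have hcyc : ¬ (SimpleGraph.Walk.cons h (q.takeUntil u hu)).IsCycle := fun hc => by
    have := hg _ _ hc
    simp at this
    omega
  rw [SimpleGraph.Walk.cons_isCycle_iff] at hcyc
  have he : s(u, v) ∈ (q.takeUntil u hu).edges := by
    by_contra hh
    exact hcyc ⟨hp, hh⟩
  cases q with
  | nil => simp at hu; exact h.ne hu
  | @cons _ x _ h' q' =>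
    have hxu : x ≠ u := by simpa using hne (by simp)
    rw [SimpleGraph.Walk.cons_isPath_iff] at hq
    have he' := SimpleGraph.Walk.edges_takeUntil_subset_edges _ hu he
    rw [SimpleGraph.Walk.edges_cons, List.mem_cons] at he'
    rcases he' with he' | he'
    · rw [Sym2.eq_iff] at he'
      rcases he' with ⟨h1, _⟩ | ⟨h1, _⟩
      · exact h.ne h1
      · exact hxu h1.symm
    · exact hq.2 (SimpleGraph.Walk.snd_mem_support_of_mem_edges _ he')

lemma cyc_aux {V W ι : Type*} {G : SimpleGraph V} {k : ℕ}
    (hg : ∀ v (c : G.Walk v v), c.IsCycle → 2 * k < c.length)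
    (inc : W → ι → Prop) (xf : W → V) (bs : ι → V)
    (hadj : ∀ x b, inc x b → G.Adj (xf x) (bs b))
    (hx : ∀ x x' b, inc x b → inc x' b → x ≠ x' → xf x ≠ xf x')
    (hb : ∀ x b b', inc x b → inc x b' → b ≠ b' → bs b ≠ bs b')
    (A : ℕ → W) (B : ℕ → ι) (hA : ∀ i j, i < j → j < k → A i ≠ A j)
    (h1 : ∀ i, i < k → inc (A i) (B i)) (h2 : ∀ i, i < k → inc (A i) (B (i + 1)))
    (hend : B k = B 0) : ∀ i, i ≤ k → B i = B 0 := by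
  have key : ∀ j, j ≤ k → ∃ p : G.Walk (bs (B j)) (bs (B 0)), p.IsPath ∧ p.length ≤ 2 * j ∧
      (p.Nil → ∀ i, i ≤ j → B i = B 0) ∧
      (¬ p.Nil → ∃ i, i < j ∧ inc (A i) (B j) ∧ p.snd = xf (A i)) := by
    intro j
    induction j with
    | zero => intro _; exact ⟨.nil, by simp, by simp, by simp, by simp⟩
    | succ j ih =>
      intro hj
      obtain ⟨p, hp, hl, hn, hs⟩ := ih (by omega)
      by_cases hB : B j = B (j + 1)
      · rw [← hB]
        refine ⟨p, hp, by omega, fun h i hi => ?_, fun h => ?_⟩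
        · rcases Nat.lt_or_ge j i with h' | h'
          · obtain rfl : i = j + 1 := by omega
            rw [← hB]; exact hn h j le_rfl
          · exact hn h i h'
        · obtain ⟨i, hi, h⟩ := hs h
          exact ⟨i, by omega, h⟩
      · have i1 := h1 j (by omega)
        have i2 := h2 j (by omega)
        have q1 := ext_path hg p hp (hadj _ _ i1) (by omega) (fun h => by
          obtain ⟨i, hi, hi', he⟩ := hs h
          rw [he]
          exact hx _ _ _ hi' i1 (hA i j hi (by omega)))
        have q2 := ext_path hg _ q1 (hadj _ _ i2).symm (by simp; omega) (fun _ => by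
          simpa using hb _ _ _ i1 i2 hB)
        refine ⟨_, q2, by simp; omega, by simp, fun _ => ⟨j, by omega, i2, by simp⟩⟩
  obtain ⟨p, hp, hl, hn, hs⟩ := key k le_rfl
  apply hn
  revert p
  rw [hend]
  intro p hp _ _ _
  exact SimpleGraph.Walk.isPath_iff_nil.mp hp

lemma card_union_aux {α : Type*} [DecidableEq α] (L : Finset (Finset α)) (D : ℕ)
    (h1 : ∀ A ∈ L, A.card = D) (h2 : ∀ A ∈ L, ∀ B ∈ L, A ≠ B → Disjoint A B) :
    (L.biUnion id).card = D * L.card := by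
  change (L.biUnion fun A => A).card = _
  rw [Finset.card_biUnion (fun A hA B hB h => h2 A hA B hB h), Finset.sum_const_nat (m := D) (fun A hA => h1 A hA), mul_comm]

set_option maxHeartbeats 1000000 in
lemma construct_aux {n : ℕ} (hn : 1 ≤ n) (G : SimpleGraph (Fin n)) (k : ℕ) (hk : 2 ≤ k)
    (hg : ∀ v (c : G.Walk v v), c.IsCycle → 2 * k < c.length) (r s t d : ℕ) (hr : 1 ≤ r)
    (ht : 1 ≤ t) (hs : 1 ≤ s) (hsd : s ≤ d) (hE : 4 * n * d ≤ G.edgeSet.ncard)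
    (h1 : 8 * (r * n) ≤ t * s)
    (h2 : 2 * ((s : ℝ) + 1) * Real.log (4 * n) < d) :
    ∃ N : ℕ, n ≤ N ∧ ∃ H : Finset (Finset (Fin N)), (∀ e ∈ H, e.card = r) ∧
          ¬ HasNonTrivialBergeCycle H k ∧
          ¬ ∃ I : Finset (Fin N), I.card = t ∧ ∀ e ∈ H, ¬ e ⊆ I := by
  classical
  have hF0 : 4 * n * d ≤
      ((Finset.univ : Finset (Fin n × Fin n)).filter (fun p => G.Adj p.1 p.2)).card := by
    have e1 : Fintype.card G.Dart ≤
        ((Finset.univ : Finset (Fin n × Fin n)).filter (fun p => G.Adj p.1 p.2)).card := by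
      rw [← Finset.card_univ]
      apply Finset.card_le_card_of_injOn (fun x => x.toProd)
      · intro x _
        simp
      · intro x _ y _ h
        exact SimpleGraph.Dart.ext _ _ h
    rw [SimpleGraph.dart_card_eq_twice_card_edges] at e1
    have : G.edgeSet.ncard = G.edgeFinset.card := by
      rw [← SimpleGraph.coe_edgeFinset, Set.ncard_coe_finset]
    omega
  obtain ⟨F, hF, hFc⟩ := Finset.exists_subset_card_eq hF0
  obtain ⟨LY, y1, y2, y3⟩ := chunk_aux (Prod.snd : Fin n × Fin n → Fin n) s (by omega) F
  have cY := card_union_aux LY s (fun A hA => (y1 A hA).2.1) y2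
  have cYF : (LY.biUnion id).card ≤ F.card :=
    Finset.card_le_card (Finset.biUnion_subset.mpr (fun A hA => (y1 A hA).1))
  obtain ⟨LX, x1, x2, x3⟩ := chunk_aux (Prod.fst : Fin n × Fin n → Fin n) d (by omega)
    (LY.biUnion id)
  have cX := card_union_aux LX d (fun A hA => (x1 A hA).2.1) x2
  have cXF : (LX.biUnion id).card ≤ (LY.biUnion id).card :=
    Finset.card_le_card (Finset.biUnion_subset.mpr (fun A hA => (x1 A hA).1))
  rw [Fintype.card_fin] at y3 x3
  have hdpos : 0 < d := by omega
  have hN1 : 2 * n ≤ LX.card := by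
    have : d * (4 * n) ≤ d * (LX.card + 2 * n) := by
      have := Nat.mul_le_mul_right n hsd
      nlinarith
    have := Nat.le_of_mul_le_mul_left this hdpos
    omega
  have hN2 : LX.card ≤ 4 * n := by
    have : d * LX.card ≤ d * (4 * n) := by nlinarith
    exact Nat.le_of_mul_le_mul_left this hdpos
  refine ⟨LX.card, by omega, ?_⟩
  let E := LX.equivFin
  let inc : Fin LX.card → {B // B ∈ LY} → Prop := fun v B => ((E.symm v).1 ∩ B.1).Nonempty
  let blk : {B // B ∈ LY} → Finset (Fin LX.card) := fun B => Finset.univ.filter (fun v => inc v B)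
  have hEinj : ∀ v v' (f : Fin n × Fin n), f ∈ (E.symm v).1 → f ∈ (E.symm v').1 → v = v' := by
    intro v v' f h h'
    by_contra hne
    have : (E.symm v).1 ≠ (E.symm v').1 := fun hh => hne (E.symm.injective (Subtype.ext hh))
    exact Finset.disjoint_left.mp (x2 _ (E.symm v).2 _ (E.symm v').2 this) h h'
  have hYinj : ∀ (B B' : {B // B ∈ LY}) (f : Fin n × Fin n), f ∈ B.1 → f ∈ B'.1 → B = B' := by
    intro v v' f h h'
    by_contra hne
    have : v.1 ≠ v'.1 := fun hh => hne (Subtype.ext hh)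
    exact Finset.disjoint_left.mp (y2 _ v.2 _ v'.2 this) h h'
  have hXf : ∀ v, ∃ x, ∀ f ∈ (E.symm v).1, f.1 = x := by
    intro v
    have hv := x1 _ (E.symm v).2
    obtain ⟨f0, hf0⟩ := Finset.card_pos.mp (by omega : 0 < (E.symm v).1.card)
    exact ⟨f0.1, fun f hf => hv.2.2 f hf f0 hf0⟩
  have hBs : ∀ B : {B // B ∈ LY}, ∃ x, ∀ f ∈ B.1, f.2 = x := by
    intro v
    have hv := y1 _ v.2
    obtain ⟨f0, hf0⟩ := Finset.card_pos.mp (by omega : 0 < v.1.card)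
    exact ⟨f0.2, fun f hf => hv.2.2 f hf f0 hf0⟩
  choose xf hxf using hXf
  choose bs hbs using hBs
  have : Nonempty (Fin LX.card) := ⟨⟨0, by omega⟩⟩
  have hprob : ∃ cen : {B // B ∈ LY} → Fin LX.card, ∀ I : Finset (Fin LX.card), I.card = t →
      ∃ b, cen b ∈ I ∧ cen b ∈ blk b ∧ r ≤ (I ∩ blk b).card := by
    refine prob_aux blk s t d r ht ?_ ?_ ?_ ?_
    · intro b
      rw [← (y1 _ b.2).2.1]
      apply Finset.card_le_card_of_forall_subsingleton (fun v f => f ∈ (E.symm v).1)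
      · intro v hv
        obtain ⟨f, hf⟩ := (Finset.mem_filter.mp hv).2
        rw [Finset.mem_inter] at hf
        exact ⟨f, hf.2, hf.1⟩
      · intro f _ v hv v' hv'
        exact hEinj v v' f hv.2 hv'.2
    · intro x
      rw [← (x1 _ (E.symm x).2).2.1]
      apply Finset.card_le_card_of_forall_subsingleton (fun f (B : {B // B ∈ LY}) => f ∈ B.1)
      · intro f hf
        obtain ⟨B, hB, hfB⟩ := Finset.mem_biUnion.mp ((x1 _ (E.symm x).2).1 hf)
        refine ⟨⟨B, hB⟩, ?_, hfB⟩
        simp only [blk, Finset.mem_filter, Finset.mem_univ, true_and, inc]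
        exact ⟨f, Finset.mem_inter.mpr ⟨hf, hfB⟩⟩
      · intro B _ f hf f' hf'
        apply Prod.ext
        · rw [hxf x f hf.1, hxf x f' hf'.1]
        · rw [hbs B f hf.2, hbs B f' hf'.2]
    · rw [Fintype.card_coe]
      have e1 : s * LY.card ≤ 4 * n * d := by omega
      have : s * (2 * (r * LY.card)) ≤ s * (t * d) := by
        calc s * (2 * (r * LY.card)) = 2 * r * (s * LY.card) := by ring
          _ ≤ 2 * r * (4 * n * d) := Nat.mul_le_mul_left _ e1
          _ = 8 * (r * n) * d := by ring
          _ ≤ t * s * d := Nat.mul_le_mul_right _ h1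
          _ = s * (t * d) := by ring
      exact Nat.le_of_mul_le_mul_left this (by omega)
    · rw [Fintype.card_fin]
      refine lt_of_le_of_lt ?_ h2
      apply mul_le_mul_of_nonneg_left _ (by positivity)
      apply Real.log_le_log
      · exact_mod_cast (by omega : 0 < LX.card)
      · exact_mod_cast hN2
  obtain ⟨cen, hcen⟩ := hprob
  · refine berge_aux k t r hk blk hr ?_ cen hcen
    intro A B hA hb1 hb2 hend
    refine cyc_aux hg inc xf bs ?_ ?_ ?_ A B hA (fun i hi => by simpa [blk] using hb1 i hi)
      (fun i hi => by simpa [blk] using hb2 i hi) hend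
    · rintro x b ⟨f, hf⟩
      rw [Finset.mem_inter] at hf
      rw [← hxf x f hf.1, ← hbs b f hf.2]
      exact (Finset.mem_filter.mp (hF ((y1 _ b.2).1 hf.2))).2
    · rintro x x' b ⟨f, hf⟩ ⟨f', hf'⟩ hne heq
      rw [Finset.mem_inter] at hf hf'
      have : f = f' := by
        apply Prod.ext
        · rw [hxf x f hf.1, hxf x' f' hf'.1, heq]
        · rw [hbs b f hf.2, hbs b f' hf'.2]
      subst this
      exact hne (hEinj _ _ f hf.1 hf'.1)
    · rintro x b b' ⟨f, hf⟩ ⟨f', hf'⟩ hne heq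
      rw [Finset.mem_inter] at hf hf'
      have : f = f' := by
        apply Prod.ext
        · rw [hxf x f hf.1, hxf x f' hf'.1]
        · rw [hbs b f hf.2, hbs b' f' hf'.2, heq]
      subst this
      exact hne (hYinj _ _ f hf.2 hf'.2)

set_option maxHeartbeats 1000000 in
lemma real_aux (k : ℕ) (hk : 2 ≤ k) (c : ℝ) (hc : 0 < c) (r n₀ : ℕ) (hr : 1 ≤ r) :
    ∃ β : ℝ, 0 < β ∧ ∃ t₀ : ℕ, ∀ t : ℕ, t₀ ≤ t → ∃ n s d : ℕ,
      β ^ ((k : ℝ) / ((k : ℝ) - 1)) * ((t : ℝ) / Real.log t) ^ ((k : ℝ) / ((k : ℝ) - 1)) ≤ n + 1 ∧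
      n₀ ≤ n ∧ 1 ≤ n ∧ 1 ≤ t ∧ 1 ≤ s ∧ s ≤ d ∧
      4 * (n : ℝ) * d ≤ c * (n : ℝ) ^ (1 + 1 / (k : ℝ)) ∧
      8 * ((r : ℝ) * n) ≤ t * s ∧ 2 * ((s : ℝ) + 1) * Real.log (4 * n) < d := by
  have hr0 : (0 : ℝ) < r := by exact_mod_cast hr
  have hk2 : (2 : ℝ) ≤ k := by exact_mod_cast hk
  obtain ⟨p, hp⟩ : ∃ p : ℝ, p = (k : ℝ) / ((k : ℝ) - 1) := ⟨_, rfl⟩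
  have hp1 : 1 ≤ p := by rw [hp, le_div_iff₀ (by linarith)]; linarith
  have hp2 : p ≤ 2 := by rw [hp, div_le_iff₀ (by linarith)]; linarith
  have hpa : p * (1 - 1 / (k : ℝ)) = 1 := by
    rw [hp]
    have : (k : ℝ) - 1 ≠ 0 := by linarith
    field_simp
  rw [← hp]
  obtain ⟨β, hβ⟩ : ∃ β : ℝ, β = min 1 (c / (3072 * r)) := ⟨_, rfl⟩
  have hβ0 : 0 < β := by rw [hβ]; exact lt_min one_pos (by positivity)
  have hβ1 : β ≤ 1 := by rw [hβ]; exact min_le_left _ _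
  have hβc : β ≤ c / (3072 * r) := by rw [hβ]; exact min_le_right _ _
  have ev1 : ∀ᶠ x : ℝ in Filter.atTop, 2 ≤ Real.log x :=
    Real.tendsto_log_atTop.eventually_ge_atTop 2
  have ev2 : ∀ᶠ x : ℝ in Filter.atTop, ‖Real.log x ^ (k + 1)‖ ≤ (β / 2 * (c / 384) ^ k) * ‖id x‖ :=
    (Real.isLittleO_pow_log_id_atTop (n := k + 1)).bound (by positivity)
  have ev3 : ∀ᶠ x : ℝ in Filter.atTop, ‖Real.log x ^ 1‖ ≤ (β / (2 * (n₀ + 1))) * ‖id x‖ :=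
    (Real.isLittleO_pow_log_id_atTop (n := 1)).bound (by positivity)
  have ev := tendsto_natCast_atTop_atTop.eventually
    (ev1.and (ev2.and (ev3.and (Filter.eventually_ge_atTop (4 : ℝ)))))
  obtain ⟨t₀, ht₀⟩ := Filter.eventually_atTop.mp ev
  refine ⟨β, hβ0, t₀, fun t ht => ?_⟩
  obtain ⟨g1, g2, g3, g4⟩ := ht₀ t ht
  obtain ⟨T, hT⟩ : ∃ T : ℝ, T = t := ⟨_, rfl⟩
  rw [← hT] at g1 g2 g3 g4 ⊢
  obtain ⟨L, hL⟩ : ∃ L : ℝ, L = Real.log T := ⟨_, rfl⟩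
  rw [← hL] at g1 g2 g3 ⊢
  have hL0 : 0 < L := by linarith
  have hT0 : 0 < T := by linarith
  simp only [id, Real.norm_eq_abs, abs_of_pos hT0] at g2 g3
  rw [abs_of_nonneg (by positivity)] at g2 g3
  obtain ⟨u, hu⟩ : ∃ u : ℝ, u = β * (T / L) := ⟨_, rfl⟩
  have hu_n0 : (n₀ : ℝ) + 1 ≤ u / 2 := by
    have hn : (0 : ℝ) < (n₀ : ℝ) + 1 := by positivity
    rw [pow_one, div_mul_eq_mul_div, le_div_iff₀ (by positivity)] at g3
    rw [hu, le_div_iff₀ (by norm_num), mul_div_assoc', le_div_iff₀ hL0]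
    linarith
  have hu2 : 2 ≤ u := by
    have : (0 : ℝ) ≤ n₀ := by positivity
    linarith
  have hu_pow : (384 * L / c) ^ k ≤ u / 2 := by
    have e : (384 * L / c) ^ k * (c / 384) ^ k = L ^ k := by
      rw [← mul_pow]; congr 1; field_simp
    rw [hu, le_div_iff₀ (by norm_num), mul_div_assoc', le_div_iff₀ hL0]
    have hcp : 0 < (c / 384) ^ k := by positivity
    refine le_of_mul_le_mul_right ?_ hcp
    calc (384 * L / c) ^ k * 2 * L * (c / 384) ^ k
        = 2 * L * ((384 * L / c) ^ k * (c / 384) ^ k) := by ring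
      _ = 2 * L ^ (k + 1) := by rw [e]; ring
      _ ≤ 2 * (β / 2 * (c / 384) ^ k * T) := by linarith
      _ = β * T * (c / 384) ^ k := by ring
  obtain ⟨n, hn⟩ : ∃ n : ℕ, n = ⌊u ^ p⌋₊ := ⟨_, rfl⟩
  have hnle : (n : ℝ) ≤ u ^ p := by rw [hn]; exact Nat.floor_le (by positivity)
  have hnlt : u ^ p < n + 1 := by rw [hn]; exact Nat.lt_floor_add_one _
  have hup : u ≤ u ^ p := by
    calc u = u ^ (1 : ℝ) := (Real.rpow_one u).symm
      _ ≤ u ^ p := Real.rpow_le_rpow_of_exponent_le (by linarith) hp1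
  have hnu : u / 2 ≤ n := by linarith
  have hn1 : (1 : ℝ) ≤ n := by linarith
  obtain ⟨m, hm⟩ : ∃ m : ℝ, m = (n : ℝ) ^ (1 / (k : ℝ)) := ⟨_, rfl⟩
  have hm0 : 0 < m := by rw [hm]; positivity
  have hmL : 384 * L / c ≤ m := by
    rw [hm, one_div]
    calc 384 * L / c = ((384 * L / c) ^ k) ^ ((k : ℝ)⁻¹) :=
          (Real.pow_rpow_inv_natCast (by positivity) (by omega)).symm
      _ ≤ (n : ℝ) ^ ((k : ℝ)⁻¹) :=
          Real.rpow_le_rpow (by positivity) (hu_pow.trans hnu) (by positivity)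
  have hnum : (n : ℝ) ≤ u * m := by
    calc (n : ℝ) = (n : ℝ) ^ ((1 - 1 / (k : ℝ)) + 1 / (k : ℝ)) := by simp
      _ = (n : ℝ) ^ (1 - 1 / (k : ℝ)) * m := by rw [Real.rpow_add (by linarith), hm]
      _ ≤ u * m := by
        apply mul_le_mul_of_nonneg_right _ hm0.le
        have ha : 0 ≤ 1 - 1 / (k : ℝ) := by
          have : 1 / (k : ℝ) ≤ 1 := by rw [div_le_iff₀ (by linarith)]; linarith
          linarith
        calc (n : ℝ) ^ (1 - 1 / (k : ℝ)) ≤ (u ^ p) ^ (1 - 1 / (k : ℝ)) :=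
              Real.rpow_le_rpow (by positivity) hnle ha
          _ = u := by rw [← Real.rpow_mul (by linarith), hpa, Real.rpow_one]
  obtain ⟨X, hX⟩ : ∃ X : ℝ, X = c * m := ⟨_, rfl⟩
  have hXL : 384 * L ≤ X := by
    rw [hX]; rw [div_le_iff₀ hc] at hmL; linarith
  have hX0 : 0 < X := by linarith
  have hlog : Real.log (4 * n) ≤ 3 * L := by
    have huT : u ≤ T := by
      rw [hu, mul_div_assoc', div_le_iff₀ hL0]
      nlinarith
    have hnT : (n : ℝ) ≤ T ^ 2 := by
      calc (n : ℝ) ≤ u ^ p := hnle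
        _ ≤ u ^ (2 : ℝ) := Real.rpow_le_rpow_of_exponent_le (by linarith) hp2
        _ = u ^ 2 := by norm_cast
        _ ≤ T ^ 2 := by gcongr
    calc Real.log (4 * n) ≤ Real.log (T ^ 3) := by
          apply Real.log_le_log (by positivity)
          nlinarith
      _ = 3 * L := by rw [Real.log_pow, hL]; norm_num
  have hlog0 : 0 ≤ Real.log (4 * n) := Real.log_nonneg (by linarith)
  obtain ⟨d, hd⟩ : ∃ d : ℕ, d = ⌊X / 4⌋₊ := ⟨_, rfl⟩
  have hd1 : (d : ℝ) ≤ X / 4 := by rw [hd]; exact Nat.floor_le (by positivity)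
  have hd2 : X / 4 < d + 1 := by rw [hd]; exact Nat.lt_floor_add_one _
  obtain ⟨s, hs⟩ : ∃ s : ℕ, s = ⌊X / (192 * L)⌋₊ := ⟨_, rfl⟩
  have hs1 : (s : ℝ) ≤ X / (192 * L) := by rw [hs]; exact Nat.floor_le (by positivity)
  have hs2 : X / (192 * L) < s + 1 := by rw [hs]; exact Nat.lt_floor_add_one _
  obtain ⟨Q, hQ⟩ : ∃ Q : ℝ, Q = X / (192 * L) := ⟨_, rfl⟩
  have hQX : Q * L = X / 192 := by rw [hQ]; field_simp
  rw [← hQ] at hs1 hs2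
  have hQ2 : 2 ≤ Q := by rw [hQ, le_div_iff₀ (by positivity)]; linarith
  have hs3 : Q / 2 ≤ s := by linarith
  have hs4 : (1 : ℝ) ≤ s := by linarith
  have hdX : X / 8 ≤ d := by linarith
  refine ⟨n, s, d, ?_, ?_, ?_, ?_, ?_, ?_, ?_, ?_, ?_⟩
  · rw [← Real.mul_rpow hβ0.le (by positivity), ← hu]
    exact hnlt.le
  · have : (n₀ : ℝ) ≤ n := by linarith
    exact_mod_cast this
  · exact_mod_cast hn1
  · have : (1 : ℝ) ≤ t := by linarith
    exact_mod_cast this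
  · exact_mod_cast hs4
  · have hQL : Q * 1 ≤ Q * L := mul_le_mul_of_nonneg_left (by linarith) (by linarith)
    have : (s : ℝ) ≤ d := by linarith
    exact_mod_cast this
  · rw [Real.rpow_add (by linarith), Real.rpow_one, ← hm]
    calc 4 * (n : ℝ) * d ≤ 4 * n * (X / 4) := by gcongr
      _ = c * (n * m) := by rw [hX]; ring
  · calc 8 * ((r : ℝ) * n) ≤ 8 * (r * (u * m)) := by gcongr
      _ = 8 * r * m * (T / L) * β := by rw [hu]; ring
      _ ≤ 8 * r * m * (T / L) * (c / (3072 * r)) := by gcongr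
      _ = T * (Q / 2) := by rw [hQ, hX]; field_simp; norm_num
      _ ≤ T * s := by gcongr
  · calc 2 * ((s : ℝ) + 1) * Real.log (4 * n) ≤ 2 * (s + s) * (3 * L) := by gcongr
      _ = 12 * (s * L) := by ring
      _ ≤ 12 * (Q * L) := by gcongr
      _ = X / 16 := by rw [hQX]; ring
      _ < d := by linarith

/-- If for some `k ≥ 2` and `c > 0` there exist, for all large `n`,
`n`-vertex graphs of girth greater than `2k` with at least `c·n^(1+1/k)` edges, then
for every `r ≥ 3` there is `c_{k,r} > 0` such that for all large `t`,
`R(t, B^r_k) ≥ c_{k,r}·(t/log t)^{k/(k-1)}`: there is a hypergraph on `n` vertices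
with `n + 1 ≥ c_{k,r}·(t/log t)^{k/(k-1)}` containing no `r`-uniform non-trivial
Berge `k`-cycle and no independent set of size `t`. -/
theorem stmt_14 (k : ℕ) (hk : 2 ≤ k) (c : ℝ) (hc : 0 < c)
    (hconstruction : ∃ n₀ : ℕ, ∀ n : ℕ, n₀ ≤ n →
      ∃ G : SimpleGraph (Fin n), (2 * k : ℕ∞) < G.girth ∧
        c * (n : ℝ) ^ (1 + 1 / (k : ℝ)) ≤ (G.edgeSet.ncard : ℝ)) :
    ∀ r : ℕ, 3 ≤ r → ∃ ckr : ℝ, 0 < ckr ∧ ∃ t₀ : ℕ, ∀ t : ℕ, t₀ ≤ t →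
      ∃ n : ℕ,
        ckr * ((t : ℝ) / Real.log t) ^ ((k : ℝ) / ((k : ℝ) - 1)) ≤ (n : ℝ) + 1 ∧
        ∃ H : Finset (Finset (Fin n)), (∀ e ∈ H, e.card = r) ∧
          ¬ HasNonTrivialBergeCycle H k ∧
          ¬ ∃ I : Finset (Fin n), I.card = t ∧ ∀ e ∈ H, ¬ e ⊆ I := by
  intro r hr
  obtain ⟨n₀, hn₀⟩ := hconstruction
  obtain ⟨β, hβ, t₀, hmain⟩ := real_aux k hk c hc r n₀ (by omega)
  refine ⟨β ^ ((k : ℝ) / ((k : ℝ) - 1)), by positivity, t₀, fun t ht => ?_⟩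
  obtain ⟨n, s, d, h0, h1, h2, h3, h4, h5, h6, h7, h8⟩ := hmain t ht
  obtain ⟨G, hG, hE⟩ := hn₀ n h1
  have hg : ∀ v (c : G.Walk v v), c.IsCycle → 2 * k < c.length := by
    intro v c hcyc
    have e1 : 2 * k < G.girth := by exact_mod_cast hG
    exact lt_of_lt_of_le e1 (SimpleGraph.girth_le_length hcyc)
  obtain ⟨N, hN, H, hH⟩ := construct_aux h2 G k hk hg r s t d (by omega) h3 h4 h5
    (by exact_mod_cast h6.trans hE) (by exact_mod_cast h7) h8
  refine ⟨N, h0.trans ?_, H, hH⟩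
  have : (n : ℝ) ≤ N := by exact_mod_cast hN
  linarith
end
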